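/- arXiv:0906.2361 — 11 statements merged into one kernel-verified Lean document; each statement's English description precedes it below -/
import Mathlib

section
/- Let u, v : ℝ² → ℝ be C¹ functions satisfying ∂u/∂t = ∂v/∂s and ∂u/∂s = ∂v/∂t on ℝ². Then there exist differentiable functions α, β : ℝ² → ℝ with ∂α/∂t = u, ∂α/∂s = v, ∂β/∂t = v and ∂β/∂s = u; that is, g = (α, β) is split-holomorphic with split-derivative g' = (u, v). (Every split-holomorphic function has a split-holomorphic primitive.) -/
/-- Partial derivative in the first (t) coordinate. -/
noncomputable def pdt {E : Type*} [NormedAddCommGroup E] [NormedSpace ℝ E]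
    (f : ℝ × ℝ → E) (p : ℝ × ℝ) : E := deriv (fun x => f (x, p.2)) p.1

/-- Partial derivative in the second (s) coordinate. -/
noncomputable def pds {E : Type*} [NormedAddCommGroup E] [NormedSpace ℝ E]
    (f : ℝ × ℝ → E) (p : ℝ × ℝ) : E := deriv (fun y => f (p.1, y)) p.2

theorem HasFDerivAt.pdt {E : Type*} [NormedAddCommGroup E] [NormedSpace ℝ E]
    {f : ℝ × ℝ → E} {f' : ℝ × ℝ →L[ℝ] E} {p : ℝ × ℝ} (h : HasFDerivAt f f' p) :
    pdt f p = f' (1, 0) :=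
  (h.comp_hasDerivAt p.1 ((hasDerivAt_id p.1).prodMk (hasDerivAt_const p.1 p.2))).deriv

theorem HasFDerivAt.pds {E : Type*} [NormedAddCommGroup E] [NormedSpace ℝ E]
    {f : ℝ × ℝ → E} {f' : ℝ × ℝ →L[ℝ] E} {p : ℝ × ℝ} (h : HasFDerivAt f f' p) :
    pds f p = f' (0, 1) :=
  (h.comp_hasDerivAt p.2 ((hasDerivAt_const p.2 p.1).prodMk (hasDerivAt_id p.2))).deriv

/-- A differentiable closed `1`-form `P dt + Q ds` on the plane is exact. -/
theorem exists_potential_of_pds_eq_pdt {P Q : ℝ × ℝ → ℝ} (hP : Differentiable ℝ P)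
    (hQ : Differentiable ℝ Q) (h : ∀ p, pds P p = pdt Q p) :
    ∃ F : ℝ × ℝ → ℝ, Differentiable ℝ F ∧ (∀ p, pdt F p = P p) ∧ ∀ p, pds F p = Q p := by
  let ω : ℝ × ℝ → ℝ × ℝ →L[ℝ] ℝ := fun p ↦
    P p • ContinuousLinearMap.fst ℝ ℝ ℝ + Q p • ContinuousLinearMap.snd ℝ ℝ ℝ
  have hω (p : ℝ × ℝ) : HasFDerivAt ω
      ((fderiv ℝ P p).smulRight (ContinuousLinearMap.fst ℝ ℝ ℝ) +
        (fderiv ℝ Q p).smulRight (ContinuousLinearMap.snd ℝ ℝ ℝ)) p :=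
    ((hP p).hasFDerivAt.smul_const (ContinuousLinearMap.fst ℝ ℝ ℝ)).add
      ((hQ p).hasFDerivAt.smul_const (ContinuousLinearMap.snd ℝ ℝ ℝ))
  obtain ⟨F, hF⟩ := convex_univ.exists_forall_hasFDerivAt_of_fderiv_symmetric isOpen_univ
    (ω := ω) (fun p _ ↦ (hω p).differentiableAt.differentiableWithinAt) (by
      intro p _ x y
      have hp : fderiv ℝ P p (0, 1) = fderiv ℝ Q p (1, 0) := by
        rw [← (hP p).hasFDerivAt.pds, h p, (hQ p).hasFDerivAt.pdt]
      have split (L : ℝ × ℝ →L[ℝ] ℝ) (z : ℝ × ℝ) :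
          L z = z.1 * L (1, 0) + z.2 * L (0, 1) := by
        conv_lhs => rw [show z = z.1 • ((1, 0) : ℝ × ℝ) + z.2 • ((0, 1) : ℝ × ℝ) by ext <;> simp]
        rw [map_add, map_smul, map_smul, smul_eq_mul, smul_eq_mul]
      rw [(hω p).fderiv]
      simp only [add_apply, ContinuousLinearMap.smulRight_apply,
        smul_apply, ContinuousLinearMap.coe_fst',
        ContinuousLinearMap.coe_snd', smul_eq_mul]
      rw [split (fderiv ℝ P p) x, split (fderiv ℝ P p) y, split (fderiv ℝ Q p) x,
        split (fderiv ℝ Q p) y, hp]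
      ring)
  refine ⟨F, fun p ↦ (hF p trivial).differentiableAt, fun p ↦ ?_, fun p ↦ ?_⟩
  · simp [(hF p trivial).pdt, ω]
  · simp [(hF p trivial).pds, ω]

/-- Every split-holomorphic function (u, v) has a split-holomorphic primitive g = (α, β)
with split-derivative g' = (u, v). -/
theorem stmt1 (u v : ℝ × ℝ → ℝ) (hu : ContDiff ℝ 1 u) (hv : ContDiff ℝ 1 v)
    (hCR1 : ∀ p : ℝ × ℝ, pdt u p = pds v p) (hCR2 : ∀ p : ℝ × ℝ, pds u p = pdt v p) :
    ∃ α β : ℝ × ℝ → ℝ, Differentiable ℝ α ∧ Differentiable ℝ β ∧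
      (∀ p : ℝ × ℝ, pdt α p = u p) ∧ (∀ p : ℝ × ℝ, pds α p = v p) ∧
      (∀ p : ℝ × ℝ, pdt β p = v p) ∧ (∀ p : ℝ × ℝ, pds β p = u p) := by
  have hu' := hu.differentiable one_ne_zero
  have hv' := hv.differentiable one_ne_zero
  obtain ⟨α, hα, hαt, hαs⟩ := exists_potential_of_pds_eq_pdt hu' hv' hCR2
  obtain ⟨β, hβ, hβt, hβs⟩ := exists_potential_of_pds_eq_pdt hv' hu' fun p ↦ (hCR1 p).symm
  exact ⟨α, β, hα, hβ, hαt, hαs, hβt, hβs⟩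
end

section
/- Let R > 0 and let c : ℕ → ℝ be coefficients such that the real power series Σₖ cₖ xᵏ converges for every x with |x| < R. Then for every (t,s) ∈ ℝ² with |t| + |s| < R/2, the split-complex power series Σₖ (cₖ, 0) ⋆ (t,s)^⋆k (powers taken with respect to the multiplication ⋆) is summable; writing its sum as (u(t,s), v(t,s)), the pair (u, v) is split-holomorphic on the open set {(t,s) : |t| + |s| < R/2}, and u(t,0) = Σₖ cₖ tᵏ and v(t,0) = 0 for |t| < R/2. (A real-analytic function extends split-holomorphically to a neighborhood of the real axis in ℂ'.) -/
/-- Split-complex multiplication on ℝ². -/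
def smul' (a b : ℝ × ℝ) : ℝ × ℝ := (a.1 * b.1 + a.2 * b.2, a.1 * b.2 + a.2 * b.1)

/-- Powers with respect to split-complex multiplication. -/
def spow (z : ℝ × ℝ) : ℕ → ℝ × ℝ
  | 0 => (1, 0)
  | n + 1 => smul' z (spow z n)

/-- The closed form of split-complex powers in null coordinates. -/
theorem spow_eq (z : ℝ × ℝ) (k : ℕ) :
    spow z k = (((z.1 + z.2) ^ k + (z.1 - z.2) ^ k) / 2,
      ((z.1 + z.2) ^ k - (z.1 - z.2) ^ k) / 2) := by
  induction k with
  | zero => simp [spow]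
  | succ k ih =>
    rw [spow, ih]
    ext <;> simp only [smul'] <;> ring

/-- A real power series is differentiable inside its interval of convergence. -/
theorem differentiableAt_tsum_mul_pow {R : ℝ} {c : ℕ → ℝ}
    (hconv : ∀ x : ℝ, |x| < R → Summable (fun k => c k * x ^ k)) {x : ℝ} (hx : |x| < R) :
    DifferentiableAt ℝ (fun y : ℝ => ∑' k, c k * y ^ k) x := by
  obtain ⟨r, hxr, hrR⟩ := exists_between hx
  have hr : 0 ≤ r := (abs_nonneg x).trans hxr.le
  lift r to NNReal using hr
  have hle : (r : ENNReal) ≤ (FormalMultilinearSeries.ofScalars ℝ c).radius := by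
    apply FormalMultilinearSeries.le_radius_of_tendsto (l := 0)
    have h := (hconv r (by simpa using hrR)).tendsto_atTop_zero.norm
    simpa [FormalMultilinearSeries.ofScalars_norm] using h
  have hxr' : ENNReal.ofReal |x| < r := by
    rw [← ENNReal.ofReal_coe_nnreal]
    exact (ENNReal.ofReal_lt_ofReal_iff_of_nonneg (abs_nonneg x)).2 hxr
  have hlt := hxr'.trans_le hle
  have hball := (FormalMultilinearSeries.ofScalars ℝ c).hasFPowerSeriesOnBall (bot_le.trans_lt hlt)
  have hd := (hball.analyticAt_of_mem (y := x) (by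
    rw [Metric.mem_eball, edist_dist, Real.dist_eq, sub_zero]
    exact hlt)).differentiableAt
  have hsum : (FormalMultilinearSeries.ofScalars ℝ c).sum = fun y : ℝ => ∑' k, c k * y ^ k :=
    FormalMultilinearSeries.ofScalarsSum_eq_tsum (E := ℝ) c
  rwa [hsum] at hd

/-- A real-analytic function, given by a power series converging on (−R, R), extends
split-holomorphically to the neighborhood {|t| + |s| < R/2} of the real axis in ℂ'. -/
theorem stmt4 (R : ℝ) (hR : 0 < R) (c : ℕ → ℝ)
    (hconv : ∀ x : ℝ, |x| < R → Summable (fun k => c k * x ^ k)) :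
    ∃ u v : ℝ × ℝ → ℝ,
      (∀ p : ℝ × ℝ, |p.1| + |p.2| < R / 2 →
        HasSum (fun k => smul' (c k, 0) (spow p k)) (u p, v p)) ∧
      (∀ p : ℝ × ℝ, |p.1| + |p.2| < R / 2 →
        pdt u p = pds v p ∧ pds u p = pdt v p) ∧
      (∀ t : ℝ, |t| < R / 2 → u (t, 0) = ∑' k, c k * t ^ k ∧ v (t, 0) = 0) := by
  have bounds : ∀ p : ℝ × ℝ, |p.1| + |p.2| < R / 2 → |p.1 + p.2| < R ∧ |p.1 - p.2| < R :=
    fun p hp => ⟨by linarith [abs_add_le p.1 p.2], by linarith [abs_sub p.1 p.2]⟩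
  set F : ℝ → ℝ := fun y => ∑' k, c k * y ^ k with hF
  refine ⟨fun p => (F (p.1 + p.2) + F (p.1 - p.2)) / 2,
    fun p => (F (p.1 + p.2) - F (p.1 - p.2)) / 2, fun p hp => ?_, fun p hp => ?_,
    fun t _ => by simp [hF]⟩
  · obtain ⟨hadd, hsub⟩ := bounds p hp
    have ha := (hconv _ hadd).hasSum
    have hs := (hconv _ hsub).hasSum
    convert ((ha.add hs).div_const 2).prodMk ((ha.sub hs).div_const 2) using 2 with k
    rw [spow_eq]
    ext <;> simp only [smul'] <;> ring
  · obtain ⟨hadd, hsub⟩ := bounds p hp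
    have ha := (differentiableAt_tsum_mul_pow hconv hadd).hasDerivAt
    have hs := (differentiableAt_tsum_mul_pow hconv hsub).hasDerivAt
    have hat := ha.comp_add_const p.1 p.2
    have hst := hs.comp_sub_const p.1 p.2
    have has := ha.comp_const_add p.1 p.2
    have hss := hs.comp_const_sub p.1 p.2
    constructor
    · exact ((hat.add hst).div_const 2).deriv.trans
        (((has.sub hss).div_const 2).deriv.trans (by ring)).symm
    · exact ((has.add hss).div_const 2).deriv.trans
        (((hat.sub hst).div_const 2).deriv.trans (by ring)).symm
end

section
/- Let r > 0 and let c : ℕ → ℝ² be a sequence of split-complex coefficients. If for every z ∈ ℝ² with ‖z‖ < r the series Σₖ cₖ ⋆ z^⋆k (powers with respect to ⋆) has sum 0, then cₖ = 0 for all k. In particular, the coefficients of a convergent split-complex power series are uniquely determined by its sum near 0. -/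
/-- A power series in one real variable with coefficients in a normed space is determined by its
sum near `0`. -/
theorem eq_zero_of_eventually_hasSum_pow_smul {E : Type*} [NormedAddCommGroup E] [NormedSpace ℝ E]
    {c : ℕ → E} (h : ∀ᶠ t in nhds (0 : ℝ), HasSum (fun k => t ^ k • c k) 0) (k : ℕ) :
    c k = 0 := by
  let p : FormalMultilinearSeries ℝ ℝ E := fun n =>
    ContinuousMultilinearMap.mkPiRing ℝ (Fin n) (c n)
  have hcoeff (n : ℕ) : p.coeff n = c n := by
    simp [p, FormalMultilinearSeries.coeff]
  have hp : HasFPowerSeriesAt 0 p (0 : ℝ) := by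
    rw [hasFPowerSeriesAt_iff]
    simpa [hcoeff] using h
  rw [← hcoeff k, hp.eq_zero]
  simp [FormalMultilinearSeries.coeff]

theorem spow_real (t : ℝ) (k : ℕ) : spow (t, 0) k = (t ^ k, 0) := by
  induction k with
  | zero => simp [spow]
  | succ k ih => simp [spow, ih, smul', pow_succ']

/-- A split-complex power series whose sum vanishes on a ball around 0 has all
coefficients equal to 0. -/
theorem stmt7 (r : ℝ) (hr : 0 < r) (c : ℕ → ℝ × ℝ)
    (h : ∀ z : ℝ × ℝ, ‖z‖ < r → HasSum (fun k => smul' (c k) (spow z k)) 0) :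
    ∀ k, c k = 0 := by
  apply eq_zero_of_eventually_hasSum_pow_smul
  filter_upwards [Metric.ball_mem_nhds (0 : ℝ) hr] with t ht
  have hz : ‖((t, 0) : ℝ × ℝ)‖ < r := by
    simpa [Prod.norm_def] using ht
  have hterm (k : ℕ) : smul' (c k) (spow (t, 0) k) = t ^ k • c k := by
    ext <;> simp [spow_real, smul', mul_comm]
  simpa only [hterm] using h _ hz
end

section
/- (Timelike Björling representation.) Let I ⊆ ℝ be a nonempty open interval and let X : D(I) → ℝ³ be a real-analytic conformal timelike minimal immersion. Set γ(t) = X(t,0) and W(t) = N(t,0), where N = (X_t ×ₗ X_s)/√⟨X_t ×ₗ X_s, X_t ×ₗ X_s⟩ is the Gauss map. Then for all (t,s) ∈ D(I): X(t,s) = ½(γ(t+s) + γ(t−s)) + ½ ∫_{t−s}^{t+s} W(τ) ×ₗ γ'(τ) dτ. (This is the split-complex Björling formula X(z) = Re(γ(z) + k' ∫ W ×ₗ γ' dw) written in null coordinates.) -/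
/-- The Minkowski inner product on ℝ³ = ℝ × ℝ × ℝ: ⟨x,y⟩ = -x₁y₁ + x₂y₂ + x₃y₃. -/
def mink (x y : ℝ × ℝ × ℝ) : ℝ := -(x.1 * y.1) + x.2.1 * y.2.1 + x.2.2 * y.2.2

/-- The Lorentzian cross product on ℝ³, characterized by ⟨u ×ₗ v, w⟩ = det[u,v,w]. -/
def lcross (u v : ℝ × ℝ × ℝ) : ℝ × ℝ × ℝ :=
  (-(u.2.1 * v.2.2 - u.2.2 * v.2.1), u.2.2 * v.1 - u.1 * v.2.2, u.1 * v.2.1 - u.2.1 * v.1)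

/-- Diamond domain D(I) = {(t,s) : t+s ∈ I and t−s ∈ I}. -/
def diamond (I : Set ℝ) : Set (ℝ × ℝ) := {p | p.1 + p.2 ∈ I ∧ p.1 - p.2 ∈ I}

/-- The Gauss map N = (X_t ×ₗ X_s)/√⟨X_t ×ₗ X_s, X_t ×ₗ X_s⟩ of a timelike surface. -/
noncomputable def gaussN (X : ℝ × ℝ → ℝ × ℝ × ℝ) (p : ℝ × ℝ) : ℝ × ℝ × ℝ :=
  (Real.sqrt (mink (lcross (pdt X p) (pds X p)) (lcross (pdt X p) (pds X p))))⁻¹ •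
    lcross (pdt X p) (pds X p)

theorem mink_lcross_self (a b : ℝ × ℝ × ℝ) :
    mink (lcross a b) (lcross a b) = mink a b ^ 2 - mink a a * mink b b := by
  simp only [mink, lcross]
  ring

theorem lcross_lcross (a b c : ℝ × ℝ × ℝ) :
    lcross (lcross a b) c = mink b c • a - mink a c • b := by
  ext <;> simp only [mink, lcross, Prod.fst_sub, Prod.snd_sub, Prod.smul_fst, Prod.smul_snd,
    smul_eq_mul] <;> ring

theorem lcross_smul_left (r : ℝ) (a b : ℝ × ℝ × ℝ) : lcross (r • a) b = r • lcross a b := by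
  ext <;> simp only [lcross, Prod.smul_fst, Prod.smul_snd, smul_eq_mul] <;> ring

theorem mink_comm (a b : ℝ × ℝ × ℝ) : mink a b = mink b a := by
  simp only [mink]
  ring

/-- In conformal coordinates, `N ×ₗ X_t = X_s`. -/
theorem lcross_gaussN_pdt {X : ℝ × ℝ → ℝ × ℝ × ℝ} {p : ℝ × ℝ}
    (h₁ : mink (pdt X p) (pdt X p) + mink (pds X p) (pds X p) = 0)
    (h₂ : mink (pdt X p) (pds X p) = 0) (h₃ : mink (pdt X p) (pdt X p) < 0) :
    lcross (gaussN X p) (pdt X p) = pds X p := by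
  have hs : mink (lcross (pdt X p) (pds X p)) (lcross (pdt X p) (pds X p)) =
      (-mink (pdt X p) (pdt X p)) ^ 2 := by
    rw [mink_lcross_self, h₂, eq_neg_of_add_eq_zero_right h₁]
    ring
  rw [gaussN, hs, Real.sqrt_sq (by linarith), lcross_smul_left, lcross_lcross,
    mink_comm (pds X p), h₂, zero_smul, zero_sub, ← neg_smul, smul_smul,
    inv_mul_cancel₀ (by linarith), one_smul]

theorem isOpen_diamond {I : Set ℝ} (hI : IsOpen I) : IsOpen (diamond I) :=
  (hI.preimage (by fun_prop : Continuous fun p : ℝ × ℝ => p.1 + p.2)).inter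
    (hI.preimage (by fun_prop : Continuous fun p : ℝ × ℝ => p.1 - p.2))

section DAlembert

variable {E : Type*} [NormedAddCommGroup E] [NormedSpace ℝ E]

theorem DifferentiableAt.pdt_eq {f : ℝ × ℝ → E} {p : ℝ × ℝ} (hf : DifferentiableAt ℝ f p) :
    pdt f p = fderiv ℝ f p (1, 0) :=
  (hf.hasFDerivAt.comp_hasDerivAt p.1
    ((hasDerivAt_id p.1).prodMk (hasDerivAt_const p.1 p.2))).deriv

theorem DifferentiableAt.pds_eq {f : ℝ × ℝ → E} {p : ℝ × ℝ} (hf : DifferentiableAt ℝ f p) :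
    pds f p = fderiv ℝ f p (0, 1) :=
  (hf.hasFDerivAt.comp_hasDerivAt p.2
    ((hasDerivAt_const p.2 p.1).prodMk (hasDerivAt_id p.2))).deriv

theorem pdt_congr {f g : ℝ × ℝ → E} {p : ℝ × ℝ} (h : f =ᶠ[nhds p] g) : pdt f p = pdt g p :=
  Filter.EventuallyEq.deriv_eq
    ((by fun_prop : ContinuousAt (fun x : ℝ => (x, p.2)) p.1).eventually h)

theorem pds_congr {f g : ℝ × ℝ → E} {p : ℝ × ℝ} (h : f =ᶠ[nhds p] g) : pds f p = pds g p :=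
  Filter.EventuallyEq.deriv_eq
    ((by fun_prop : ContinuousAt (fun y : ℝ => (p.1, y)) p.2).eventually h)

theorem Set.OrdConnected.eq_of_hasDerivAt_zero {S : Set ℝ} (hc : S.OrdConnected) {f : ℝ → E}
    (hf : ∀ x ∈ S, HasDerivAt f 0 x) {x y : ℝ} (hx : x ∈ S) (hy : y ∈ S) : f x = f y := by
  have := hc.convex.norm_image_sub_le_of_norm_hasDerivWithin_le (C := 0)
    (fun z hz => (hf z hz).hasDerivWithinAt) (by simp) hy hx
  simpa [sub_eq_zero] using this

variable [CompleteSpace E] {I : Set ℝ} {X : ℝ × ℝ → E}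

theorem fderiv_fderiv_eq_of_wave (hI : IsOpen I) (hX : AnalyticOnNhd ℝ X (diamond I))
    {p : ℝ × ℝ} (hp : p ∈ diamond I) (hw : pdt (pdt X) p = pds (pds X) p) :
    fderiv ℝ (fderiv ℝ X) p (1, 0) (1, 0) = fderiv ℝ (fderiv ℝ X) p (0, 1) (0, 1) := by
  have hd : DifferentiableAt ℝ (fderiv ℝ X) p := (hX.fderiv p hp).differentiableAt
  have hev : ∀ᶠ q in nhds p, DifferentiableAt ℝ X q :=
    Filter.eventually_of_mem ((isOpen_diamond hI).mem_nhds hp)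
      fun q hq => (hX q hq).differentiableAt
  rw [pdt_congr (g := fun q => fderiv ℝ X q (1, 0)) (hev.mono fun q hq => hq.pdt_eq),
    pds_congr (g := fun q => fderiv ℝ X q (0, 1)) (hev.mono fun q hq => hq.pds_eq),
    DifferentiableAt.pdt_eq (by fun_prop), DifferentiableAt.pds_eq (by fun_prop),
    fderiv_clm_apply hd (by fun_prop), fderiv_clm_apply hd (by fun_prop)] at hw
  simpa using hw

/-- The null derivatives of a solution of the wave equation are transported along the
characteristics of the opposite family. -/
theorem fderiv_null_eq_of_wave (hI : IsOpen I) (hord : I.OrdConnected)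
    (hX : AnalyticOnNhd ℝ X (diamond I))
    (hw : ∀ p ∈ diamond I, pdt (pdt X) p = pds (pds X) p) {ε : ℝ} (hε : ε = 1 ∨ ε = -1)
    {p : ℝ × ℝ} (hp : p ∈ diamond I) :
    fderiv ℝ X p (1, ε) = fderiv ℝ X (p.1 + ε * p.2, 0) (1, ε) := by
  have hc : {r : ℝ | (p.1 + r, p.2 - ε * r) ∈ diamond I}.OrdConnected := by
    refine ⟨fun x hx y hy z hz => ?_⟩
    simp only [diamond, Set.mem_ofPred_eq] at hx hy ⊢
    obtain ⟨hxz, hzy⟩ := hz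
    rcases hε with rfl | rfl <;>
      exact ⟨hord.out hx.1 hy.1 ⟨by linarith, by linarith⟩,
        hord.out hx.2 hy.2 ⟨by linarith, by linarith⟩⟩
  have hderiv : ∀ r ∈ {r : ℝ | (p.1 + r, p.2 - ε * r) ∈ diamond I},
      HasDerivAt (fun r : ℝ => fderiv ℝ X (p.1 + r, p.2 - ε * r) (1, ε)) 0 r := by
    intro r hr
    have hd := (hX.fderiv _ hr).differentiableAt.hasFDerivAt
    have hpath : HasDerivAt (fun r : ℝ => (p.1 + r, p.2 - ε * r)) (1, -ε) r := by
      simpa using ((hasDerivAt_id r).const_add p.1).prodMk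
        (((hasDerivAt_id r).const_mul ε).const_sub p.2)
    have hcomp : HasDerivAt (fun r : ℝ => fderiv ℝ X (p.1 + r, p.2 - ε * r))
        (fderiv ℝ (fderiv ℝ X) (p.1 + r, p.2 - ε * r) (1, -ε)) r :=
      HasFDerivAt.comp_hasDerivAt (f := fun r : ℝ => (p.1 + r, p.2 - ε * r)) r hd hpath
    have h := hcomp.clm_apply (hasDerivAt_const r ((1, ε) : ℝ × ℝ))
    have hsymm : fderiv ℝ (fderiv ℝ X) (p.1 + r, p.2 - ε * r) (1, 0) (0, 1) =
        fderiv ℝ (fderiv ℝ X) (p.1 + r, p.2 - ε * r) (0, 1) (1, 0) :=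
      ((hX _ hr).contDiffAt (n := 2)).isSymmSndFDerivAt (by simp) _ _
    have hwave := fderiv_fderiv_eq_of_wave hI hX hr (hw _ hr)
    refine h.congr_deriv ?_
    have e₁ : ((1, -ε) : ℝ × ℝ) = (1, 0) - ε • (0, 1) := by simp
    have e₂ : ((1, ε) : ℝ × ℝ) = (1, 0) + ε • (0, 1) := by simp
    rw [e₁, e₂]
    simp only [map_sub, map_add, map_smul, sub_apply,
      smul_apply, map_zero, add_zero, hsymm, hwave]
    rcases hε with rfl | rfl <;> module
  have h := hc.eq_of_hasDerivAt_zero hderiv (x := 0) (y := ε * p.2) (by simpa using hp) (by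
    rcases hε with rfl | rfl
    · simpa [diamond] using hp.1
    · simpa [diamond, sub_eq_add_neg] using hp.2)
  have hsq : ε * (ε * p.2) = p.2 := by rcases hε with rfl | rfl <;> ring
  simpa [hsq] using h

/-- D'Alembert's formula. -/
theorem dAlembert (hI : IsOpen I) (hord : I.OrdConnected)
    (hX : AnalyticOnNhd ℝ X (diamond I))
    (hw : ∀ p ∈ diamond I, pdt (pdt X) p = pds (pds X) p) {p : ℝ × ℝ} (hp : p ∈ diamond I) :
    X p = (1 / 2 : ℝ) • (X (p.1 + p.2, 0) + X (p.1 - p.2, 0)) +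
      (1 / 2 : ℝ) • ∫ τ in (p.1 - p.2)..(p.1 + p.2), pds X (τ, 0) := by
  obtain ⟨t, s⟩ := p
  have haxis : ∀ {τ : ℝ}, τ ∈ I → (τ, (0 : ℝ)) ∈ diamond I := fun h => by simpa [diamond] using h
  have ht : t ∈ I := by
    rcases le_total 0 s with h | h
    · exact hord.out hp.2 hp.1 ⟨by simpa using h, by simpa using h⟩
    · exact hord.out hp.1 hp.2 ⟨by simpa using h, by simpa using h⟩
  have hcont : ContinuousOn (fun τ : ℝ => pds X (τ, 0)) I := by
    have h : ContinuousOn (fun τ : ℝ => fderiv ℝ X (τ, 0) (0, 1)) I :=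
      (hX.fderiv.continuousOn.comp (by fun_prop) fun τ hτ => haxis hτ).clm_apply
        continuousOn_const
    exact h.congr fun τ hτ => (hX _ (haxis hτ)).differentiableAt.pds_eq
  have hint : ∀ {a b : ℝ}, a ∈ I → b ∈ I →
      IntervalIntegrable (fun τ : ℝ => pds X (τ, 0)) MeasureTheory.volume a b :=
    fun ha hb => (hcont.mono (hord.uIcc_subset ha hb)).intervalIntegrable
  have hprim : ∀ {b : ℝ}, b ∈ I →
      HasDerivAt (fun b => ∫ τ in t..b, pds X (τ, 0)) (pds X (b, 0)) b := fun hb =>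
    intervalIntegral.integral_hasDerivAt_right (hint ht hb)
      (hcont.stronglyMeasurableAtFilter hI _ hb) (hcont.continuousAt (hI.mem_nhds hb))
  have haxisd : ∀ {τ : ℝ}, τ ∈ I →
      HasDerivAt (fun τ => X (τ, 0)) (fderiv ℝ X (τ, 0) (1, 0)) τ := fun {τ} hτ =>
    (hX _ (haxis hτ)).differentiableAt.hasFDerivAt.comp_hasDerivAt τ
      ((hasDerivAt_id τ).prodMk (hasDerivAt_const τ 0))
  have hc : {σ : ℝ | (t, σ) ∈ diamond I}.OrdConnected := by
    refine ⟨fun x hx y hy z hz => ?_⟩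
    simp only [diamond, Set.mem_ofPred_eq] at hx hy ⊢
    obtain ⟨hxz, hzy⟩ := hz
    exact ⟨hord.out hx.1 hy.1 ⟨by linarith, by linarith⟩,
      hord.out hy.2 hx.2 ⟨by linarith, by linarith⟩⟩
  have hderiv : ∀ σ ∈ {σ : ℝ | (t, σ) ∈ diamond I},
      HasDerivAt (fun σ : ℝ => X (t, σ) - ((1 / 2 : ℝ) • (X (t + σ, 0) + X (t - σ, 0)) +
        (1 / 2 : ℝ) • ((∫ τ in t..(t + σ), pds X (τ, 0)) - ∫ τ in t..(t - σ), pds X (τ, 0))))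
        0 σ := by
    intro σ hσ
    have hplus : HasDerivAt (fun σ : ℝ => t + σ) 1 σ := (hasDerivAt_id σ).const_add t
    have hminus : HasDerivAt (fun σ : ℝ => t - σ) (-1) σ := (hasDerivAt_id σ).const_sub t
    have hv : HasDerivAt (fun σ => X (t, σ)) (fderiv ℝ X (t, σ) (0, 1)) σ :=
      (hX _ hσ).differentiableAt.hasFDerivAt.comp_hasDerivAt σ
        ((hasDerivAt_const σ t).prodMk (hasDerivAt_id σ))
    have h := hv.sub (((((haxisd hσ.1).scomp σ hplus).add
      ((haxisd hσ.2).scomp σ hminus)).const_smul (1 / 2 : ℝ)).add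
      ((((hprim hσ.1).scomp σ hplus).sub ((hprim hσ.2).scomp σ hminus)).const_smul (1 / 2 : ℝ)))
    refine h.congr_deriv ?_
    have n₁ := fderiv_null_eq_of_wave hI hord hX hw (ε := 1) (Or.inl rfl) hσ
    have n₂ := fderiv_null_eq_of_wave hI hord hX hw (ε := -1) (Or.inr rfl) hσ
    have e₁ : ((1, 1) : ℝ × ℝ) = (1, 0) + (0, 1) := by simp
    have e₂ : ((1, -1) : ℝ × ℝ) = (1, 0) - (0, 1) := by simp
    rw [e₁, map_add, map_add, one_mul] at n₁
    rw [e₂, map_sub, map_sub, neg_one_mul, ← sub_eq_add_neg] at n₂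
    simp only at n₁ n₂ ⊢
    rw [(hX _ (haxis hσ.1)).differentiableAt.pds_eq, (hX _ (haxis hσ.2)).differentiableAt.pds_eq]
    linear_combination (norm := module) (1 / 2 : ℝ) • n₁ - (1 / 2 : ℝ) • n₂
  have h := hc.eq_of_hasDerivAt_zero hderiv (x := s) (y := 0) hp (by simpa [diamond] using ht)
  rw [intervalIntegral.integral_interval_sub_left (hint ht hp.1) (hint ht hp.2)] at h
  refine sub_eq_zero.mp (h.trans ?_)
  simp only [add_zero, sub_zero, sub_self, smul_zero]
  module

end DAlembert

/-- Timelike Björling representation: a real-analytic conformal timelike minimal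
immersion X on the diamond D(I) is recovered from γ(t) = X(t,0) and W(t) = N(t,0) by
X(t,s) = ½(γ(t+s) + γ(t−s)) + ½ ∫_{t−s}^{t+s} W(τ) ×ₗ γ'(τ) dτ. -/
theorem stmt9 (I : Set ℝ) (hI : IsOpen I) (hne : I.Nonempty) (hord : I.OrdConnected)
    (X : ℝ × ℝ → ℝ × ℝ × ℝ) (hX : AnalyticOnNhd ℝ X (diamond I))
    (hconf : ∀ p ∈ diamond I,
      mink (pdt X p) (pdt X p) + mink (pds X p) (pds X p) = 0 ∧
      mink (pdt X p) (pds X p) = 0 ∧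
      mink (pdt X p) (pdt X p) < 0 ∧
      pdt (pdt X) p = pds (pds X) p) :
    ∀ p ∈ diamond I,
      X p = (1 / 2 : ℝ) • (X (p.1 + p.2, 0) + X (p.1 - p.2, 0)) +
        (1 / 2 : ℝ) • ∫ τ in (p.1 - p.2)..(p.1 + p.2),
          lcross (gaussN X (τ, 0)) (deriv (fun t => X (t, 0)) τ) := by
  intro p hp
  rw [dAlembert hI hord hX (fun q hq => (hconf q hq).2.2.2) hp]
  congr 2
  refine intervalIntegral.integral_congr fun τ hτ => ?_
  have hτI : (τ, (0 : ℝ)) ∈ diamond I := by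
    simpa [diamond] using hord.uIcc_subset hp.2 hp.1 hτ
  obtain ⟨h₁, h₂, h₃, -⟩ := hconf _ hτI
  exact (lcross_gaussN_pdt h₁ h₂ h₃).symm
end

section
/- (Uniqueness for the timelike Björling problem.) Let I ⊆ ℝ be a nonempty open interval and U ⊆ ℝ² an open connected set containing I×{0}. Suppose X₁, X₂ : U → ℝ³ are real-analytic maps each satisfying the wave equation ∂²X/∂t² = ∂²X/∂s² on U, and suppose X₁(t,0) = X₂(t,0) and ∂X₁/∂s(t,0) = ∂X₂/∂s(t,0) for all t ∈ I. Then X₁ = X₂ on all of U. (Consequently two real-analytic timelike minimal surfaces containing the same curve with the same Gauss map along it coincide.) -/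
section PartialDerivatives

variable {E : Type*} [NormedAddCommGroup E] [NormedSpace ℝ E] {f : ℝ × ℝ → E} {p : ℝ × ℝ}

theorem pdt_eq_fderiv (hf : DifferentiableAt ℝ f p) : pdt f p = fderiv ℝ f p (1, 0) := by
  have hline : HasDerivAt (fun x : ℝ => (x, p.2)) ((1, 0) : ℝ × ℝ) p.1 :=
    (hasDerivAt_id p.1).prodMk (hasDerivAt_const p.1 p.2)
  exact (hf.hasFDerivAt.comp_hasDerivAt (f := fun x : ℝ => (x, p.2)) p.1 hline).deriv

theorem pds_eq_fderiv (hf : DifferentiableAt ℝ f p) : pds f p = fderiv ℝ f p (0, 1) := by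
  have hline : HasDerivAt (fun y : ℝ => (p.1, y)) ((0, 1) : ℝ × ℝ) p.2 :=
    (hasDerivAt_const p.2 p.1).prodMk (hasDerivAt_id p.2)
  exact (hf.hasFDerivAt.comp_hasDerivAt (f := fun y : ℝ => (p.1, y)) p.2 hline).deriv

theorem fderiv_apply_const (hf : ContDiffAt ℝ 2 f p) (v : ℝ × ℝ) :
    HasFDerivAt (fun q => fderiv ℝ f q v) ((fderiv ℝ (fderiv ℝ f) p).flip v) p := by
  have h : DifferentiableAt ℝ (fderiv ℝ f) p :=
    (hf.fderiv_right (m := 1) (by norm_num)).differentiableAt one_ne_zero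
  exact ((ContinuousLinearMap.apply ℝ E v).hasFDerivAt.comp p h.hasFDerivAt)

theorem eventually_differentiableAt (hf : ContDiffAt ℝ 2 f p) :
    ∀ᶠ q in nhds p, DifferentiableAt ℝ f q :=
  (hf.eventually (by simp)).mono fun _ hq => hq.differentiableAt two_ne_zero

theorem pdt_pdt_eq_fderiv (hf : ContDiffAt ℝ 2 f p) :
    pdt (pdt f) p = fderiv ℝ (fderiv ℝ f) p (1, 0) (1, 0) := by
  have h : HasFDerivAt (pdt f) ((fderiv ℝ (fderiv ℝ f) p).flip (1, 0)) p :=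
    (fderiv_apply_const hf (1, 0)).congr_of_eventuallyEq
      ((eventually_differentiableAt hf).mono fun _ hq => pdt_eq_fderiv hq)
  rw [pdt_eq_fderiv h.differentiableAt, h.fderiv, ContinuousLinearMap.flip_apply]

theorem pds_pds_eq_fderiv (hf : ContDiffAt ℝ 2 f p) :
    pds (pds f) p = fderiv ℝ (fderiv ℝ f) p (0, 1) (0, 1) := by
  have h : HasFDerivAt (pds f) ((fderiv ℝ (fderiv ℝ f) p).flip (0, 1)) p :=
    (fderiv_apply_const hf (0, 1)).congr_of_eventuallyEq
      ((eventually_differentiableAt hf).mono fun _ hq => pds_eq_fderiv hq)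
  rw [pds_eq_fderiv h.differentiableAt, h.fderiv, ContinuousLinearMap.flip_apply]

/-- The wave operator factors into the two characteristic derivatives `∂t ± ∂s`. -/
theorem fderiv_fderiv_characteristic (hf : ContDiffAt ℝ 2 f p)
    (hw : pdt (pdt f) p = pds (pds f) p) {e : ℝ} (he : e * e = 1) :
    fderiv ℝ (fderiv ℝ f) p (-e, 1) (1, e) = 0 := by
  rw [pdt_pdt_eq_fderiv hf, pds_pds_eq_fderiv hf] at hw
  have hsymm := (hf.isSymmSndFDerivAt (by simp)).eq (1, 0) (0, 1)
  have h₁ : ((-e, 1) : ℝ × ℝ) = (-e) • (1, 0) + (0, 1) := by simp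
  have h₂ : ((1, e) : ℝ × ℝ) = (1, 0) + e • (0, 1) := by simp
  rw [h₁, h₂]
  simp only [map_add, map_smul, add_apply, smul_apply]
  rw [hw, hsymm, smul_add, smul_smul, mul_neg, he]
  module

/-- On a square centred on the `t`-axis, a solution of the wave equation with vanishing Cauchy data
on the axis has vanishing characteristic derivatives. -/
theorem fderiv_characteristic_eq_zero {t₀ r : ℝ}
    (hf : ∀ q ∈ Metric.ball (t₀, (0 : ℝ)) r, ContDiffAt ℝ 2 f q)
    (hw : ∀ q ∈ Metric.ball (t₀, (0 : ℝ)) r, pdt (pdt f) q = pds (pds f) q)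
    (h₀ : ∀ t ∈ Metric.ball t₀ r, fderiv ℝ f (t, 0) = 0) {e : ℝ} (he : e * e = 1)
    (hp : p ∈ Metric.ball (t₀, (0 : ℝ)) (r / 2)) :
    fderiv ℝ f p (1, e) = 0 := by
  obtain ⟨t, s⟩ := p
  have habs : |e| = 1 := by
    rcases mul_self_eq_one_iff.mp he with rfl | rfl <;> simp
  simp only [← ball_prod_same, Set.mem_prod, Metric.mem_ball, Real.dist_eq, sub_zero] at hp hf hw h₀
  have hmem : ∀ u ∈ Set.uIcc 0 s, |t + e * s - e * u - t₀| < r ∧ |u| < r := by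
    intro u hu
    have hu₁ : |u| ≤ |s| := by simpa using Set.abs_sub_left_of_mem_uIcc hu
    have hu₂ : |s - u| ≤ |s| := by simpa using Set.abs_sub_right_of_mem_uIcc hu
    have htri := abs_add_le (t - t₀) (e * (s - u))
    rw [abs_mul, habs, one_mul] at htri
    rw [show t + e * s - e * u - t₀ = t - t₀ + e * (s - u) by ring]
    constructor <;> linarith [hp.1, hp.2, abs_nonneg s]
  have hderiv : ∀ u ∈ Set.uIcc 0 s,
      HasDerivWithinAt (fun u => fderiv ℝ f (t + e * s - e * u, u) (1, e)) 0 (Set.uIcc 0 s) u := by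
    intro u hu
    have hline : HasDerivAt (fun u : ℝ => (t + e * s - e * u, u)) ((-e, 1) : ℝ × ℝ) u := by
      refine HasDerivAt.prodMk ?_ (hasDerivAt_id u)
      simpa using ((hasDerivAt_id u).const_mul e).const_sub (t + e * s)
    have h := (fderiv_apply_const (hf (t + e * s - e * u, u) (hmem u hu)) (1, e)).comp_hasDerivAt
      (f := fun u : ℝ => (t + e * s - e * u, u)) u hline
    rw [ContinuousLinearMap.flip_apply, fderiv_fderiv_characteristic
      (hf (t + e * s - e * u, u) (hmem u hu)) (hw (t + e * s - e * u, u) (hmem u hu)) he] at h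
    exact h.hasDerivWithinAt
  have hconst := (convex_uIcc (0 : ℝ) s).norm_image_sub_le_of_norm_hasDerivWithin_le (C := 0)
    hderiv (fun _ _ => by simp) Set.left_mem_uIcc Set.right_mem_uIcc
  have haxis : |t + e * s - t₀| < r := by simpa using (hmem 0 Set.left_mem_uIcc).1
  simpa [h₀ _ haxis] using hconst

end PartialDerivatives

/-- Uniqueness for the timelike Björling problem: two real-analytic solutions of the wave
equation on a connected open set U ⊇ I×{0} agreeing to first order along I×{0} coincide. -/
theorem stmt12 (I : Set ℝ) (hI : IsOpen I) (hIne : I.Nonempty) (hord : I.OrdConnected)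
    (U : Set (ℝ × ℝ)) (hU : IsOpen U) (hUconn : IsConnected U)
    (hIU : ∀ t ∈ I, (t, (0 : ℝ)) ∈ U)
    (X₁ X₂ : ℝ × ℝ → ℝ × ℝ × ℝ)
    (h1 : AnalyticOnNhd ℝ X₁ U) (h2 : AnalyticOnNhd ℝ X₂ U)
    (hw1 : ∀ p ∈ U, pdt (pdt X₁) p = pds (pds X₁) p)
    (hw2 : ∀ p ∈ U, pdt (pdt X₂) p = pds (pds X₂) p)
    (hbd1 : ∀ t ∈ I, X₁ (t, 0) = X₂ (t, 0))
    (hbd2 : ∀ t ∈ I, pds X₁ (t, 0) = pds X₂ (t, 0)) :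
    ∀ p ∈ U, X₁ p = X₂ p := by
  obtain ⟨t₀, ht₀⟩ := hIne
  have hY : AnalyticOnNhd ℝ (X₁ - X₂) U := h1.sub h2
  have hYc : ∀ q ∈ U, ContDiffAt ℝ 2 (X₁ - X₂) q := fun q hq => (hY q hq).contDiffAt
  have hYw : ∀ q ∈ U, pdt (pdt (X₁ - X₂)) q = pds (pds (X₁ - X₂)) q := by
    intro q hq
    have c₁ : ContDiffAt ℝ 2 X₁ q := (h1 q hq).contDiffAt
    have c₂ : ContDiffAt ℝ 2 X₂ q := (h2 q hq).contDiffAt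
    have hw₁ := hw1 q hq
    have hw₂ := hw2 q hq
    rw [pdt_pdt_eq_fderiv c₁, pds_pds_eq_fderiv c₁] at hw₁
    rw [pdt_pdt_eq_fderiv c₂, pds_pds_eq_fderiv c₂] at hw₂
    have hD : fderiv ℝ (X₁ - X₂) =ᶠ[nhds q] fderiv ℝ X₁ - fderiv ℝ X₂ := by
      filter_upwards [eventually_differentiableAt c₁, eventually_differentiableAt c₂] with x d₁ d₂
      exact fderiv_sub d₁ d₂
    have hD2 := hD.fderiv_eq.trans (fderiv_sub
      ((c₁.fderiv_right (m := 1) (by norm_num)).differentiableAt one_ne_zero)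
      ((c₂.fderiv_right (m := 1) (by norm_num)).differentiableAt one_ne_zero))
    rw [pdt_pdt_eq_fderiv (hYc q hq), pds_pds_eq_fderiv (hYc q hq), hD2]
    simp [hw₁, hw₂]
  have hY₀ : ∀ t ∈ I, fderiv ℝ (X₁ - X₂) (t, 0) = 0 := by
    intro t ht
    have hd := (hY _ (hIU t ht)).differentiableAt
    have d₁ := (h1 _ (hIU t ht)).differentiableAt
    have d₂ := (h2 _ (hIU t ht)).differentiableAt
    have ht' : fderiv ℝ (X₁ - X₂) (t, 0) (1, 0) = 0 := by
      rw [← pdt_eq_fderiv hd]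
      have : (fun x => (X₁ - X₂) (x, 0)) =ᶠ[nhds t] fun _ => 0 := by
        filter_upwards [hI.mem_nhds ht] with x hx
        simp [hbd1 x hx]
      exact this.deriv_eq.trans (deriv_const _ _)
    have hs' : fderiv ℝ (X₁ - X₂) (t, 0) (0, 1) = 0 := by
      rw [fderiv_sub d₁ d₂, sub_apply, ← pds_eq_fderiv d₁, ← pds_eq_fderiv d₂,
        hbd2 t ht, sub_self]
    refine ContinuousLinearMap.ext fun v => ?_
    have hv : v = v.1 • ((1, 0) : ℝ × ℝ) + v.2 • ((0, 1) : ℝ × ℝ) := by ext <;> simp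
    rw [hv, map_add, map_smul, map_smul, ht', hs']
    simp
  obtain ⟨r₁, hr₁, hUr⟩ := Metric.isOpen_iff.mp hU _ (hIU t₀ ht₀)
  obtain ⟨r₂, hr₂, hIr⟩ := Metric.isOpen_iff.mp hI _ ht₀
  set r := min r₁ r₂ with hr
  have hrpos : 0 < r := lt_min hr₁ hr₂
  have hU' : Metric.ball (t₀, (0 : ℝ)) r ⊆ U :=
    (Metric.ball_subset_ball (min_le_left _ _)).trans hUr
  have hI' : Metric.ball t₀ r ⊆ I := (Metric.ball_subset_ball (min_le_right _ _)).trans hIr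
  have hfd : ∀ q ∈ Metric.ball (t₀, (0 : ℝ)) (r / 2), fderiv ℝ (X₁ - X₂) q = 0 := by
    intro q hq
    have hchar (e : ℝ) (he : e * e = 1) : fderiv ℝ (X₁ - X₂) q (1, e) = 0 :=
      fderiv_characteristic_eq_zero (fun q hq => hYc q (hU' hq)) (fun q hq => hYw q (hU' hq))
        (fun t ht => hY₀ t (hI' ht)) he hq
    refine ContinuousLinearMap.ext fun v => ?_
    have hv : v = ((v.1 + v.2) / 2) • ((1, 1) : ℝ × ℝ) + ((v.1 - v.2) / 2) • ((1, -1) : ℝ × ℝ) := by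
      ext <;> simp <;> ring
    rw [hv, map_add, map_smul, map_smul, hchar 1 (by norm_num), hchar (-1) (by norm_num)]
    simp
  have hsub : Metric.ball (t₀, (0 : ℝ)) (r / 2) ⊆ U :=
    (Metric.ball_subset_ball (by linarith)).trans hU'
  have hcenter : (t₀, (0 : ℝ)) ∈ Metric.ball (t₀, (0 : ℝ)) (r / 2) :=
    Metric.mem_ball_self (by linarith)
  have hzero : X₁ =ᶠ[nhds (t₀, 0)] X₂ := by
    filter_upwards [Metric.isOpen_ball.mem_nhds hcenter] with q hq
    have h := (convex_ball (t₀, (0 : ℝ)) (r / 2)).is_const_of_fderivWithin_eq_zero (𝕜 := ℝ)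
      (f := X₁ - X₂)
      (fun x hx => (hY x (hsub hx)).differentiableAt.differentiableWithinAt)
      (fun x hx => (fderivWithin_of_isOpen Metric.isOpen_ball hx).trans (hfd x hx)) hq hcenter
    simpa [hbd1 t₀ ht₀, sub_eq_zero] using h
  exact h1.eqOn_of_preconnected_of_eventuallyEq h2 hUconn.isPreconnected (hIU t₀ ht₀) hzero
end

section
/- Let I ⊆ ℝ be a nonempty open interval and a, b : I → ℝ real-analytic functions with a'(t)² − b'(t)² > 0 for all t ∈ I, so that γ(t) = (a(t), 0, b(t)) is a timelike curve in the x₁x₃-plane. Define X : D(I) → ℝ³ by X(t,s) = (½(a(t+s) + a(t−s)), ½ ∫_{t−s}^{t+s} √(a'(τ)² − b'(τ)²) dτ, ½(b(t+s) + b(t−s))). Then: X(t,0) = (a(t), 0, b(t)) and ∂X/∂s(t,0) = (0, √(a'(t)² − b'(t)²), 0) for all t ∈ I, so X meets the x₁x₃-plane orthogonally along γ; X_tt = X_ss, ⟨X_t,X_s⟩ = 0 and ⟨X_t,X_t⟩ + ⟨X_s,X_s⟩ = 0 hold on all of D(I); and there exists an open set U with I×{0} ⊆ U ⊆ D(I)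 on which ⟨X_t,X_t⟩ < 0, so that X restricted to U is a conformal timelike minimal immersion. -/
section DAlembert

variable {E : Type*} [NormedAddCommGroup E] [NormedSpace ℝ E] {I : Set ℝ}
  {f : ℝ × ℝ → E} {F G F' G' : ℝ → E}

/-- The `t`-derivative of a superposition `F (t + s) + G (t - s)` of travelling waves. -/
theorem pdt_eq_of_eq_add (hI : IsOpen I)
    (hf : ∀ p ∈ diamond I, f p = F (p.1 + p.2) + G (p.1 - p.2))
    (hF : ∀ u ∈ I, HasDerivAt F (F' u) u) (hG : ∀ u ∈ I, HasDerivAt G (G' u) u) :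
    ∀ p ∈ diamond I, pdt f p = F' (p.1 + p.2) + G' (p.1 - p.2) := by
  rintro ⟨t, s⟩ hp
  have hnhds : ∀ᶠ x in nhds t, (x, s) ∈ diamond I :=
    (Continuous.prodMk_left s).continuousAt.eventually_mem ((isOpen_diamond hI).mem_nhds hp)
  have hderiv : HasDerivAt (fun x => F (x + s) + G (x - s)) (F' (t + s) + G' (t - s)) t :=
    ((hF _ hp.1).comp_add_const t s).add ((hG _ hp.2).comp_sub_const t s)
  exact (hderiv.congr_of_eventuallyEq (hnhds.mono fun x hx => hf _ hx)).deriv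

/-- The `s`-derivative of a superposition `F (t + s) + G (t - s)` of travelling waves. -/
theorem pds_eq_of_eq_add (hI : IsOpen I)
    (hf : ∀ p ∈ diamond I, f p = F (p.1 + p.2) + G (p.1 - p.2))
    (hF : ∀ u ∈ I, HasDerivAt F (F' u) u) (hG : ∀ u ∈ I, HasDerivAt G (G' u) u) :
    ∀ p ∈ diamond I, pds f p = F' (p.1 + p.2) + -G' (p.1 - p.2) := by
  rintro ⟨t, s⟩ hp
  have hnhds : ∀ᶠ y in nhds s, (t, y) ∈ diamond I :=
    (Continuous.prodMk_right t).continuousAt.eventually_mem ((isOpen_diamond hI).mem_nhds hp)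
  have hderiv : HasDerivAt (fun y => F (t + y) + G (t - y)) (F' (t + s) + -G' (t - s)) s :=
    ((hF _ hp.1).comp_const_add t s).add ((hG _ hp.2).comp_const_sub t s)
  exact (hderiv.congr_of_eventuallyEq (hnhds.mono fun y hy => hf _ hy)).deriv

/-- A superposition of twice differentiable travelling waves solves the wave equation. -/
theorem pdt_pdt_eq_pds_pds_of_eq_add (hI : IsOpen I)
    (hf : ∀ p ∈ diamond I, f p = F (p.1 + p.2) + G (p.1 - p.2))
    (hF : ∀ u ∈ I, HasDerivAt F (F' u) u) (hG : ∀ u ∈ I, HasDerivAt G (G' u) u)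
    (hF' : ∀ u ∈ I, DifferentiableAt ℝ F' u) (hG' : ∀ u ∈ I, DifferentiableAt ℝ G' u) :
    ∀ p ∈ diamond I, pdt (pdt f) p = pds (pds f) p := by
  intro p hp
  rw [pdt_eq_of_eq_add hI (pdt_eq_of_eq_add hI hf hF hG) (fun u hu => (hF' u hu).hasDerivAt)
      (fun u hu => (hG' u hu).hasDerivAt) p hp,
    pds_eq_of_eq_add hI (G := fun u => -G' u) (pds_eq_of_eq_add hI hf hF hG)
      (fun u hu => (hF' u hu).hasDerivAt) (fun u hu => (hG' u hu).hasDerivAt.neg) p hp, neg_neg]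

end DAlembert

/-- A primitive of a function continuous on an open interval. -/
theorem ContinuousOn.hasDerivAt_integral {I : Set ℝ} (hI : IsOpen I) (hord : I.OrdConnected)
    {g : ℝ → ℝ} (hg : ContinuousOn g I) {c u : ℝ} (hc : c ∈ I) (hu : u ∈ I) :
    HasDerivAt (fun x => ∫ τ in c..x, g τ) (g u) u :=
  intervalIntegral.integral_hasDerivAt_right
    (hg.mono (hord.uIcc_subset hc hu)).intervalIntegrable
    (hg.stronglyMeasurableAtFilter hI u hu) (hg.continuousAt (hI.mem_nhds hu))

/-- The Björling solution for a timelike curve γ(t) = (a(t), 0, b(t)) in the x₁x₃-plane: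
the resulting timelike minimal surface meets the plane orthogonally along γ. -/
theorem stmt14 (I : Set ℝ) (hI : IsOpen I) (hne : I.Nonempty) (hord : I.OrdConnected)
    (a b : ℝ → ℝ) (ha : AnalyticOnNhd ℝ a I) (hb : AnalyticOnNhd ℝ b I)
    (htime : ∀ t ∈ I, 0 < (deriv a t) ^ 2 - (deriv b t) ^ 2)
    (X : ℝ × ℝ → ℝ × ℝ × ℝ)
    (hXdef : ∀ p : ℝ × ℝ, X p =
      ((a (p.1 + p.2) + a (p.1 - p.2)) / 2,
       (∫ τ in (p.1 - p.2)..(p.1 + p.2), Real.sqrt ((deriv a τ) ^ 2 - (deriv b τ) ^ 2)) / 2,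
       (b (p.1 + p.2) + b (p.1 - p.2)) / 2)) :
    (∀ t ∈ I, X (t, 0) = (a t, 0, b t) ∧
        pds X (t, 0) = (0, Real.sqrt ((deriv a t) ^ 2 - (deriv b t) ^ 2), 0)) ∧
    (∀ p ∈ diamond I, pdt (pdt X) p = pds (pds X) p ∧
        mink (pdt X p) (pds X p) = 0 ∧
        mink (pdt X p) (pdt X p) + mink (pds X p) (pds X p) = 0) ∧
    (∃ U : Set (ℝ × ℝ), IsOpen U ∧ (∀ t ∈ I, (t, (0 : ℝ)) ∈ U) ∧ U ⊆ diamond I ∧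
        ∀ p ∈ U, mink (pdt X p) (pdt X p) < 0) := by
  set g : ℝ → ℝ := fun τ => Real.sqrt ((deriv a τ) ^ 2 - (deriv b τ) ^ 2) with hg
  have ha' : ∀ u ∈ I, DifferentiableAt ℝ (deriv a) u := fun u hu => (ha.deriv u hu).differentiableAt
  have hb' : ∀ u ∈ I, DifferentiableAt ℝ (deriv b) u := fun u hu => (hb.deriv u hu).differentiableAt
  have hg' : ∀ u ∈ I, DifferentiableAt ℝ g u := fun u hu =>
    (((ha' u hu).pow 2).sub ((hb' u hu).pow 2)).sqrt (htime u hu).ne'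
  have hgc : ContinuousOn g I := fun u hu => (hg' u hu).continuousAt.continuousWithinAt
  have hgsq : ∀ u ∈ I, g u ^ 2 = deriv a u ^ 2 - deriv b u ^ 2 := fun u hu =>
    Real.sq_sqrt (htime u hu).le
  obtain ⟨c, hc⟩ := hne
  have hint : ∀ u ∈ I, HasDerivAt (fun x => ∫ τ in c..x, g τ) (g u) u := fun u hu =>
    hgc.hasDerivAt_integral hI hord hc hu
  have haD : ∀ u ∈ I, HasDerivAt a (deriv a u) u := fun u hu => (ha u hu).differentiableAt.hasDerivAt
  have hbD : ∀ u ∈ I, HasDerivAt b (deriv b u) u := fun u hu => (hb u hu).differentiableAt.hasDerivAt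
  have hX : ∀ p ∈ diamond I, X p =
      (fun u => (a u / 2, (∫ τ in c..u, g τ) / 2, b u / 2)) (p.1 + p.2) +
      (fun u => (a u / 2, -(∫ τ in c..u, g τ) / 2, b u / 2)) (p.1 - p.2) := by
    rintro p ⟨hu, hv⟩
    have hsub := intervalIntegral.integral_interval_sub_left
      (hgc.mono (hord.uIcc_subset hc hu)).intervalIntegrable
      (hgc.mono (hord.uIcc_subset hc hv)).intervalIntegrable (μ := MeasureTheory.volume)
    rw [hXdef, ← hsub]
    ext <;> simp <;> ring
  have hF : ∀ u ∈ I, HasDerivAt (fun u => (a u / 2, (∫ τ in c..u, g τ) / 2, b u / 2))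
      ((fun u => (deriv a u / 2, g u / 2, deriv b u / 2)) u) u := fun u hu =>
    ((haD u hu).div_const 2).prodMk (((hint u hu).div_const 2).prodMk ((hbD u hu).div_const 2))
  have hG : ∀ u ∈ I, HasDerivAt (fun u => (a u / 2, -(∫ τ in c..u, g τ) / 2, b u / 2))
      ((fun u => (deriv a u / 2, -g u / 2, deriv b u / 2)) u) u := fun u hu =>
    ((haD u hu).div_const 2).prodMk
      (((hint u hu).neg.div_const 2).prodMk ((hbD u hu).div_const 2))
  have hXt := pdt_eq_of_eq_add hI hX hF hG
  have hXs := pds_eq_of_eq_add hI hX hF hG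
  refine ⟨fun t ht => ⟨?_, ?_⟩, fun p hp => ⟨?_, ?_, ?_⟩, ?_⟩
  · rw [hXdef]
    ext <;> simp
  · rw [hXs (t, 0) (by simpa [diamond] using ht)]
    ext <;> simp [hg]
    ring
  · exact pdt_pdt_eq_pds_pds_of_eq_add hI hX hF hG
      (fun u hu => ((ha' u hu).div_const 2).prodMk
        (((hg' u hu).div_const 2).prodMk ((hb' u hu).div_const 2)))
      (fun u hu => ((ha' u hu).div_const 2).prodMk
        (((hg' u hu).neg.div_const 2).prodMk ((hb' u hu).div_const 2))) p hp
  · rw [hXt p hp, hXs p hp]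
    simp only [mink, Prod.fst_add, Prod.snd_add, Prod.fst_neg, Prod.snd_neg]
    linear_combination (hgsq _ hp.1 - hgsq _ hp.2) / 4
  · rw [hXt p hp, hXs p hp]
    simp only [mink, Prod.fst_add, Prod.snd_add, Prod.fst_neg, Prod.snd_neg]
    linear_combination (hgsq _ hp.1 + hgsq _ hp.2) / 2
  · have hcont : ContinuousOn (fun p => mink (pdt X p) (pdt X p)) (diamond I) := by
      have hac : ContinuousOn (deriv a) I := ha.deriv.continuousOn
      have hbc : ContinuousOn (deriv b) I := hb.deriv.continuousOn
      have hplus : ContinuousOn (fun p : ℝ × ℝ => p.1 + p.2) (diamond I) := by fun_prop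
      have hminus : ContinuousOn (fun p : ℝ × ℝ => p.1 - p.2) (diamond I) := by fun_prop
      have h1 := hac.comp hplus fun p hp => hp.1
      have h2 := hac.comp hminus fun p hp => hp.2
      have h3 := hbc.comp hplus fun p hp => hp.1
      have h4 := hbc.comp hminus fun p hp => hp.2
      have h5 := hgc.comp hplus fun p hp => hp.1
      have h6 := hgc.comp hminus fun p hp => hp.2
      have hform := ((h1.mul h2).neg.add (h3.mul h4)).sub (h5.mul h6) |>.div_const 2
      refine hform.congr fun p hp => ?_
      simp only [hXt p hp, mink, Prod.fst_add, Prod.snd_add, Function.comp_apply, Pi.mul_apply,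
        Pi.add_apply, Pi.sub_apply, Pi.neg_apply]
      linear_combination (hgsq _ hp.1 + hgsq _ hp.2) / 4
    refine ⟨_, hcont.isOpen_inter_preimage (isOpen_diamond hI) isOpen_Iio, fun t ht => ?_,
      Set.inter_subset_left, fun p hp => hp.2⟩
    have hmem : (t, (0 : ℝ)) ∈ diamond I := by simpa [diamond] using ht
    refine ⟨hmem, ?_⟩
    simp only [Set.mem_preimage, Set.mem_Iio, hXt _ hmem, mink, Prod.fst_add, Prod.snd_add,
      add_zero, sub_zero]
    linarith [htime t ht]
end

section
/- (Minimal timelike surfaces of revolution with timelike axis are Lorentzian elliptic catenoids.) Let I ⊆ ℝ be a nonempty open interval and a, b : I → ℝ be C² functions with b(t) ≠ 0 for all t ∈ I. Define X(t,s) = (a(t), b(t)·cos s, b(t)·sin s) for t ∈ I, s ∈ ℝ, and suppose that for all t ∈ I and s ∈ ℝ: ⟨X_t,X_t⟩ + ⟨X_s,X_s⟩ = 0 (conformality, equivalently −a'(t)² + b'(t)² + b(t)² = 0) and X_tt = X_ss (minimality, equivalently a'' = 0 and b'' = −b). Then there exist constants A ≠ 0, B and θ such that a(t) = A·t + B and b(t)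 = A·cos(t − θ) for all t ∈ I. -/
theorem IsOpen.exists_eq_of_hasDerivAt_zero {I : Set ℝ} (hI : IsOpen I) (hc : I.OrdConnected)
    {f : ℝ → ℝ} (hf : ∀ t ∈ I, HasDerivAt f 0 t) : ∃ c, ∀ t ∈ I, f t = c :=
  hI.exists_is_const_of_deriv_eq_zero hc.isPreconnected
    (fun t ht => (hf t ht).differentiableAt.differentiableWithinAt) (fun t ht => (hf t ht).deriv)

theorem Real.exists_cos_sin_of_sq_add_sq {x y : ℝ} (h : x ^ 2 + y ^ 2 = 1) :
    ∃ θ : ℝ, Real.cos θ = x ∧ Real.sin θ = y := by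
  have hn : ‖(⟨x, y⟩ : ℂ)‖ = 1 := by
    rw [Complex.norm_eq_sqrt_sq_add_sq]
    simp [h]
  refine ⟨Complex.arg ⟨x, y⟩, ?_, ?_⟩
  · have := Complex.norm_mul_cos_arg (⟨x, y⟩ : ℂ)
    rwa [hn, one_mul] at this
  · have := Complex.norm_mul_sin_arg (⟨x, y⟩ : ℂ)
    rwa [hn, one_mul] at this

theorem ContDiffOn.hasDerivAt_and_hasDerivAt_deriv {I : Set ℝ} (hI : IsOpen I) {f : ℝ → ℝ}
    (hf : ContDiffOn ℝ 2 f I) {t : ℝ} (ht : t ∈ I) :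
    HasDerivAt f (deriv f t) t ∧ HasDerivAt (deriv f) (deriv (deriv f) t) t := by
  have h1 : ContDiffOn ℝ 1 (deriv f) I := hf.deriv_of_isOpen hI (by norm_num)
  exact ⟨((hf.differentiableOn (by norm_num)).differentiableAt (hI.mem_nhds ht)).hasDerivAt,
    ((h1.differentiableOn (by norm_num)).differentiableAt (hI.mem_nhds ht)).hasDerivAt⟩

/-- A solution of `b'' = -b` on an open interval is a combination of `cos` and `sin`. -/
theorem exists_cos_sin_of_deriv_deriv_eq_neg {I : Set ℝ} (hI : IsOpen I) (hc : I.OrdConnected)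
    {b b' : ℝ → ℝ} (hb : ∀ t ∈ I, HasDerivAt b (b' t) t)
    (hb' : ∀ t ∈ I, HasDerivAt b' (-b t) t) :
    ∃ c d : ℝ, ∀ t ∈ I, b t = c * Real.cos t + d * Real.sin t ∧
      b' t = d * Real.cos t - c * Real.sin t := by
  obtain ⟨c, hcc⟩ := hI.exists_eq_of_hasDerivAt_zero hc
    (f := fun t => b t * Real.cos t - b' t * Real.sin t) fun t ht => by
      refine (((hb t ht).mul (Real.hasDerivAt_cos t)).sub
        ((hb' t ht).mul (Real.hasDerivAt_sin t))).congr_deriv ?_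
      ring
  obtain ⟨d, hd⟩ := hI.exists_eq_of_hasDerivAt_zero hc
    (f := fun t => b t * Real.sin t + b' t * Real.cos t) fun t ht => by
      refine (((hb t ht).mul (Real.hasDerivAt_sin t)).add
        ((hb' t ht).mul (Real.hasDerivAt_cos t))).congr_deriv ?_
      ring
  refine ⟨c, d, fun t ht => ?_⟩
  have h1 := hcc t ht
  have h2 := hd t ht
  have h3 := Real.sin_sq_add_cos_sq t
  constructor
  · rw [← h1, ← h2]
    linear_combination (-b t) * h3
  · rw [← h1, ← h2]
    linear_combination (-b' t) * h3

theorem pdt_revolution {a b : ℝ → ℝ} {t a' b' : ℝ} (ha : HasDerivAt a a' t)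
    (hb : HasDerivAt b b' t) (s : ℝ) :
    pdt (fun p : ℝ × ℝ => (a p.1, b p.1 * Real.cos p.2, b p.1 * Real.sin p.2)) (t, s) =
      (a', b' * Real.cos s, b' * Real.sin s) :=
  (ha.prodMk ((hb.mul_const (Real.cos s)).prodMk (hb.mul_const (Real.sin s)))).deriv

theorem pds_revolution (a b : ℝ → ℝ) :
    pds (fun p : ℝ × ℝ => (a p.1, b p.1 * Real.cos p.2, b p.1 * Real.sin p.2)) =
      fun p => (0, b p.1 * -Real.sin p.2, b p.1 * Real.cos p.2) := by
  funext p
  exact ((hasDerivAt_const p.2 (a p.1)).prodMk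
    (((Real.hasDerivAt_cos p.2).const_mul (b p.1)).prodMk
      ((Real.hasDerivAt_sin p.2).const_mul (b p.1)))).deriv

theorem pds_pds_revolution (a b : ℝ → ℝ) (p : ℝ × ℝ) :
    pds (pds (fun p : ℝ × ℝ => (a p.1, b p.1 * Real.cos p.2, b p.1 * Real.sin p.2))) p =
      (0, b p.1 * -Real.cos p.2, b p.1 * -Real.sin p.2) := by
  rw [pds_revolution]
  exact ((hasDerivAt_const p.2 (0 : ℝ)).prodMk
    (((Real.hasDerivAt_sin p.2).neg.const_mul (b p.1)).prodMk
      ((Real.hasDerivAt_cos p.2).const_mul (b p.1)))).deriv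

/-- Minimal timelike surfaces of revolution with timelike axis are Lorentzian elliptic
catenoids: conformality and minimality force a(t) = At + B and b(t) = A cos(t − θ). -/
theorem stmt15 (I : Set ℝ) (hI : IsOpen I) (hne : I.Nonempty) (hord : I.OrdConnected)
    (a b : ℝ → ℝ) (ha : ContDiffOn ℝ 2 a I) (hb : ContDiffOn ℝ 2 b I)
    (hbne : ∀ t ∈ I, b t ≠ 0)
    (X : ℝ × ℝ → ℝ × ℝ × ℝ)
    (hXdef : ∀ p : ℝ × ℝ, X p = (a p.1, b p.1 * Real.cos p.2, b p.1 * Real.sin p.2))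
    (hconf : ∀ t ∈ I, ∀ s : ℝ,
      mink (pdt X (t, s)) (pdt X (t, s)) + mink (pds X (t, s)) (pds X (t, s)) = 0)
    (hmin : ∀ t ∈ I, ∀ s : ℝ, pdt (pdt X) (t, s) = pds (pds X) (t, s)) :
    ∃ A B θ : ℝ, A ≠ 0 ∧ ∀ t ∈ I, a t = A * t + B ∧ b t = A * Real.cos (t - θ) := by
  obtain rfl : X = fun p => (a p.1, b p.1 * Real.cos p.2, b p.1 * Real.sin p.2) := funext hXdef
  have da := fun t (ht : t ∈ I) => ha.hasDerivAt_and_hasDerivAt_deriv hI ht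
  have db := fun t (ht : t ∈ I) => hb.hasDerivAt_and_hasDerivAt_deriv hI ht
  have hX1 : ∀ t ∈ I, ∀ s, pdt (fun p : ℝ × ℝ => (a p.1, b p.1 * Real.cos p.2,
      b p.1 * Real.sin p.2)) (t, s) = (deriv a t, deriv b t * Real.cos s, deriv b t * Real.sin s) :=
    fun t ht s => pdt_revolution (da t ht).1 (db t ht).1 s
  have hode : ∀ t ∈ I, deriv (deriv a) t = 0 ∧ deriv (deriv b) t = -b t := by
    intro t ht
    have h := hmin t ht 0
    rw [pds_pds_revolution, pdt] at h
    have hev : (fun x => pdt (fun p : ℝ × ℝ => (a p.1, b p.1 * Real.cos p.2,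
        b p.1 * Real.sin p.2)) (x, 0)) =ᶠ[nhds t] fun x =>
        (deriv a x, deriv b x * Real.cos 0, deriv b x * Real.sin 0) :=
      Filter.eventually_of_mem (hI.mem_nhds ht) fun x hx => hX1 x hx 0
    have h2 := hev.deriv_eq.symm.trans h
    rw [((da t ht).2.prodMk (((db t ht).2.mul_const _).prodMk
      ((db t ht).2.mul_const _))).deriv] at h2
    simpa using h2
  have hE : ∀ t ∈ I, deriv a t ^ 2 = deriv b t ^ 2 + b t ^ 2 := by
    intro t ht
    have h := hconf t ht 0
    rw [hX1 t ht, pds_revolution] at h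
    simp only [mink, Real.cos_zero, Real.sin_zero] at h
    linear_combination -h
  obtain ⟨A, hA⟩ := hI.exists_eq_of_hasDerivAt_zero hord fun t ht =>
    (hode t ht).1 ▸ (da t ht).2
  obtain ⟨B, hB⟩ := hI.exists_eq_of_hasDerivAt_zero hord
    (f := fun t => a t - A * t) fun t ht => by
      refine ((da t ht).1.sub ((hasDerivAt_id t).const_mul A)).congr_deriv ?_
      rw [hA t ht]
      ring
  obtain ⟨c, d, hcd⟩ := exists_cos_sin_of_deriv_deriv_eq_neg hI hord (fun t ht => (db t ht).1)
    fun t ht => (hode t ht).2 ▸ (db t ht).2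
  obtain ⟨t₀, ht₀⟩ := hne
  have hE₀ := hE t₀ ht₀
  rw [hA t₀ ht₀] at hE₀
  have hA0 : A ≠ 0 := by
    rintro rfl
    have := sq_pos_of_ne_zero (hbne t₀ ht₀)
    nlinarith [sq_nonneg (deriv b t₀)]
  have hnorm : c ^ 2 + d ^ 2 = A ^ 2 := by
    rw [hE₀, (hcd t₀ ht₀).1, (hcd t₀ ht₀).2]
    linear_combination (-(c ^ 2 + d ^ 2)) * Real.sin_sq_add_cos_sq t₀
  obtain ⟨θ, hcos, hsin⟩ := Real.exists_cos_sin_of_sq_add_sq (x := c / A) (y := d / A) (by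
    rw [div_pow, div_pow, ← add_div, hnorm, div_self (pow_ne_zero 2 hA0)])
  refine ⟨A, B, θ, hA0, fun t ht => ⟨?_, ?_⟩⟩
  · linear_combination hB t ht
  · rw [Real.cos_sub, hcos, hsin, (hcd t ht).1]
    field_simp
end

section
/- (Minimal timelike surfaces of revolution with spacelike profile curve.) Let I ⊆ ℝ be a nonempty open interval and a, b : I → ℝ be C² functions with a(s) ≠ 0 for all s ∈ I. Define X(t,s) = (a(s)·sinh t, a(s)·cosh t, b(s)) for t ∈ ℝ, s ∈ I, and suppose that for all t ∈ ℝ and s ∈ I: ⟨X_t,X_t⟩ + ⟨X_s,X_s⟩ = 0 (equivalently −a(s)² + a'(s)² + b'(s)² = 0) and X_tt = X_ss (equivalently a'' = a and b'' = 0). Then either b is constant on I and there exist C ≠ 0 and ε ∈ {1,−1} with a(s) = C·e^{εs} for all s ∈ I (the surface lies in a Lorentzian plane), or there exist constants A ≠ 0, B, θ and ε ∈ {1,−1} such that b(s) = A·s + B and a(s) = ε·A·cosh(s + θ) for all s ∈ I. -/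
/-- A function with zero derivative on an open order-connected set is constant there. -/
theorem exists_eq_const_of_hasDerivAt_zero {I : Set ℝ} (hI : IsOpen I) (hord : I.OrdConnected)
    {f : ℝ → ℝ} (hf : ∀ s ∈ I, HasDerivAt f 0 s) : ∃ c, ∀ s ∈ I, f s = c :=
  hI.exists_is_const_of_deriv_eq_zero hord.isPreconnected
    (fun s hs => (hf s hs).differentiableAt.differentiableWithinAt) fun s hs => (hf s hs).deriv

/-- Functions equal to their second derivative on an interval are combinations of `exp s` and
`exp (-s)`. -/
theorem exists_exp_of_second_deriv_eq_self {I : Set ℝ} (hI : IsOpen I) (hord : I.OrdConnected)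
    {a a' : ℝ → ℝ} (h₁ : ∀ s ∈ I, HasDerivAt a (a' s) s) (h₂ : ∀ s ∈ I, HasDerivAt a' (a s) s) :
    ∃ P Q : ℝ, ∀ s ∈ I, a s = P * Real.exp s + Q * Real.exp (-s) ∧
      a' s = P * Real.exp s - Q * Real.exp (-s) := by
  obtain ⟨p, hp⟩ := exists_eq_const_of_hasDerivAt_zero hI hord
    (f := fun s => (a s + a' s) * Real.exp (-s)) fun s hs => by
      refine (((h₁ s hs).add (h₂ s hs)).mul (hasDerivAt_neg s).exp).congr_deriv ?_
      simp only [Pi.add_apply]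
      ring
  obtain ⟨q, hq⟩ := exists_eq_const_of_hasDerivAt_zero hI hord
    (f := fun s => (a s - a' s) * Real.exp s) fun s hs => by
      refine (((h₁ s hs).sub (h₂ s hs)).mul (Real.hasDerivAt_exp s)).congr_deriv ?_
      simp only [Pi.sub_apply]
      ring
  refine ⟨p / 2, q / 2, fun s hs => ?_⟩
  have hexp : Real.exp s * Real.exp (-s) = 1 := by rw [← Real.exp_add]; simp
  rw [← hp s hs, show q = _ from (hq s hs).symm]
  constructor
  · linear_combination (-a s) * hexp
  · linear_combination (-a' s) * hexp

/-- A function with zero second derivative on an interval is affine there. -/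
theorem exists_affine_of_hasDerivAt {I : Set ℝ} (hI : IsOpen I) (hord : I.OrdConnected)
    {b b' : ℝ → ℝ} (h₁ : ∀ s ∈ I, HasDerivAt b (b' s) s) (h₂ : ∀ s ∈ I, HasDerivAt b' 0 s) :
    ∃ m d : ℝ, ∀ s ∈ I, b' s = m ∧ b s = m * s + d := by
  obtain ⟨m, hm⟩ := exists_eq_const_of_hasDerivAt_zero hI hord h₂
  obtain ⟨d, hd⟩ := exists_eq_const_of_hasDerivAt_zero hI hord
    (f := fun s => b s - m * s) fun s hs => by
      refine ((h₁ s hs).sub ((hasDerivAt_id s).const_mul m)).congr_deriv ?_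
      rw [hm s hs]
      ring
  exact ⟨m, d, fun s hs => ⟨hm s hs, by linarith [hd s hs]⟩⟩

/-- A combination of `exp s` and `exp (-s)` with `m ^ 2 = 4 * P * Q ≠ 0` is a translated,
scaled hyperbolic cosine. -/
theorem exists_cosh_of_sq_eq {P Q m : ℝ} (hm : m ≠ 0) (h : m ^ 2 = 4 * P * Q) :
    ∃ θ ε : ℝ, (ε = 1 ∨ ε = -1) ∧
      ∀ s, P * Real.exp s + Q * Real.exp (-s) = ε * m * Real.cosh (s + θ) := by
  have hP : P ≠ 0 := by
    rintro rfl
    exact hm (pow_eq_zero_iff two_ne_zero |>.1 (by simpa using h))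
  obtain ⟨ε, hε, hpos⟩ : ∃ ε : ℝ, (ε = 1 ∨ ε = -1) ∧ 0 < 2 * P * ε / m := by
    rcases lt_or_gt_of_ne (div_ne_zero hP hm) with hneg | hpos
    · exact ⟨-1, Or.inr rfl, by rw [show 2 * P * (-1) / m = -2 * (P / m) by ring]; linarith⟩
    · exact ⟨1, Or.inl rfl, by rw [show 2 * P * 1 / m = 2 * (P / m) by ring]; linarith⟩
  have hεsq : ε ^ 2 = 1 := by rcases hε with rfl | rfl <;> norm_num
  have hε0 : ε ≠ 0 := by rintro rfl; norm_num at hεsq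
  refine ⟨Real.log (2 * P * ε / m), ε, hε, fun s => ?_⟩
  have hQ : Q = m ^ 2 / (4 * P) := by field_simp; linarith
  rw [Real.cosh_eq, neg_add, Real.exp_add, Real.exp_add, Real.exp_neg (Real.log _),
    Real.exp_log hpos, hQ]
  field_simp
  linear_combination (-16 * P ^ 2 * Real.exp s) * hεsq

/-- Minimal timelike surfaces of revolution with spacelike profile curve: either the
surface is part of a Lorentzian plane (a(s) = C e^{εs}, b constant), or
b(s) = As + B and a(s) = εA cosh(s + θ). -/
theorem stmt16 (I : Set ℝ) (hI : IsOpen I) (hne : I.Nonempty) (hord : I.OrdConnected)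
    (a b : ℝ → ℝ) (ha : ContDiffOn ℝ 2 a I) (hb : ContDiffOn ℝ 2 b I)
    (hane : ∀ s ∈ I, a s ≠ 0)
    (X : ℝ × ℝ → ℝ × ℝ × ℝ)
    (hXdef : ∀ p : ℝ × ℝ, X p = (a p.2 * Real.sinh p.1, a p.2 * Real.cosh p.1, b p.2))
    (hconf : ∀ t : ℝ, ∀ s ∈ I,
      mink (pdt X (t, s)) (pdt X (t, s)) + mink (pds X (t, s)) (pds X (t, s)) = 0)
    (hmin : ∀ t : ℝ, ∀ s ∈ I, pdt (pdt X) (t, s) = pds (pds X) (t, s)) :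
    (∃ d C ε : ℝ, C ≠ 0 ∧ (ε = 1 ∨ ε = -1) ∧
      ∀ s ∈ I, b s = d ∧ a s = C * Real.exp (ε * s)) ∨
    (∃ A B θ ε : ℝ, A ≠ 0 ∧ (ε = 1 ∨ ε = -1) ∧
      ∀ s ∈ I, b s = A * s + B ∧ a s = ε * A * Real.cosh (s + θ)) := by
  have hda : ∀ s ∈ I, HasDerivAt a (deriv a s) s := fun s hs =>
    ((ha.differentiableOn two_ne_zero).differentiableAt (hI.mem_nhds hs)).hasDerivAt
  have hdb : ∀ s ∈ I, HasDerivAt b (deriv b s) s := fun s hs =>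
    ((hb.differentiableOn two_ne_zero).differentiableAt (hI.mem_nhds hs)).hasDerivAt
  have hda' : ∀ s ∈ I, HasDerivAt (deriv a) (deriv (deriv a) s) s := fun s hs =>
    (((ha.deriv_of_isOpen (m := 1) hI (by norm_num)).differentiableOn one_ne_zero).differentiableAt
      (hI.mem_nhds hs)).hasDerivAt
  have hdb' : ∀ s ∈ I, HasDerivAt (deriv b) (deriv (deriv b) s) s := fun s hs =>
    (((hb.deriv_of_isOpen (m := 1) hI (by norm_num)).differentiableOn one_ne_zero).differentiableAt
      (hI.mem_nhds hs)).hasDerivAt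
  have hXt : ∀ t s, pdt X (t, s) = (a s * Real.cosh t, a s * Real.sinh t, 0) := fun t s => by
    simp only [pdt, hXdef]
    exact (((Real.hasDerivAt_sinh t).const_mul (a s)).prodMk
      (((Real.hasDerivAt_cosh t).const_mul (a s)).prodMk (hasDerivAt_const t (b s)))).deriv
  have hXtt : ∀ t s, pdt (pdt X) (t, s) = (a s * Real.sinh t, a s * Real.cosh t, 0) :=
    fun t s => by
      rw [pdt]
      simp only [hXt]
      exact (((Real.hasDerivAt_cosh t).const_mul (a s)).prodMk
        (((Real.hasDerivAt_sinh t).const_mul (a s)).prodMk (hasDerivAt_const t (0 : ℝ)))).deriv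
  have hXs : ∀ t, ∀ s ∈ I,
      pds X (t, s) = (deriv a s * Real.sinh t, deriv a s * Real.cosh t, deriv b s) :=
    fun t s hs => by
      simp only [pds, hXdef]
      exact (((hda s hs).mul_const _).prodMk (((hda s hs).mul_const _).prodMk (hdb s hs))).deriv
  have hXss : ∀ t, ∀ s ∈ I, pds (pds X) (t, s) =
      (deriv (deriv a) s * Real.sinh t, deriv (deriv a) s * Real.cosh t, deriv (deriv b) s) :=
    fun t s hs => by
      have heq : (fun y => pds X (t, y)) =ᶠ[nhds s] fun y =>
          (deriv a y * Real.sinh t, deriv a y * Real.cosh t, deriv b y) :=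
        Filter.eventuallyEq_of_mem (hI.mem_nhds hs) (hXs t)
      rw [pds]
      exact ((((hda' s hs).mul_const _).prodMk
        (((hda' s hs).mul_const _).prodMk (hdb' s hs))).congr_of_eventuallyEq heq).deriv
  have hode : ∀ s ∈ I, deriv (deriv a) s = a s ∧ deriv (deriv b) s = 0 := fun s hs => by
    have h := hmin 0 s hs
    rw [hXtt, hXss 0 s hs] at h
    simp only [Real.sinh_zero, Real.cosh_zero, mul_one, Prod.mk.injEq] at h
    exact ⟨h.2.1.symm, h.2.2.symm⟩
  have hspeed : ∀ s ∈ I, -(a s) ^ 2 + deriv a s ^ 2 + deriv b s ^ 2 = 0 := fun s hs => by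
    have h := hconf 0 s hs
    rw [hXt, hXs 0 s hs] at h
    simp only [mink, Real.sinh_zero, Real.cosh_zero] at h
    linarith
  obtain ⟨P, Q, hPQ⟩ := exists_exp_of_second_deriv_eq_self hI hord hda
    fun s hs => (hode s hs).1 ▸ hda' s hs
  obtain ⟨m, d, hmd⟩ := exists_affine_of_hasDerivAt hI hord hdb
    fun s hs => (hode s hs).2 ▸ hdb' s hs
  obtain ⟨s₀, hs₀⟩ := hne
  have hrel : m ^ 2 = 4 * P * Q := by
    have h := hspeed s₀ hs₀
    have hexp : Real.exp s₀ * Real.exp (-s₀) = 1 := by rw [← Real.exp_add]; simp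
    rw [(hPQ s₀ hs₀).1, (hPQ s₀ hs₀).2, (hmd s₀ hs₀).1] at h
    linear_combination h + 4 * P * Q * hexp
  have hPQ0 : ¬(P = 0 ∧ Q = 0) := fun ⟨hP, hQ⟩ =>
    hane s₀ hs₀ (by simp [(hPQ s₀ hs₀).1, hP, hQ])
  by_cases hm : m = 0
  · left
    have hprod : P * Q = 0 := by rw [hm] at hrel; linarith
    rcases mul_eq_zero.1 hprod with hP | hQ
    · exact ⟨d, Q, -1, fun hQ => hPQ0 ⟨hP, hQ⟩, Or.inr rfl, fun s hs =>
        ⟨by simp [(hmd s hs).2, hm], by simp [(hPQ s hs).1, hP]⟩⟩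
    · exact ⟨d, P, 1, fun hP => hPQ0 ⟨hP, hQ⟩, Or.inl rfl, fun s hs =>
        ⟨by simp [(hmd s hs).2, hm], by simp [(hPQ s hs).1, hQ]⟩⟩
  · right
    obtain ⟨θ, ε, hε, hcosh⟩ := exists_cosh_of_sq_eq hm hrel
    exact ⟨m, d, θ, ε, hm, hε, fun s hs => ⟨(hmd s hs).2, (hPQ s hs).1.trans (hcosh s)⟩⟩
end

section
/- (Minimal timelike surfaces of revolution with lightlike axis are Lorentzian parabolic catenoids.) Let I ⊆ ℝ be a nonempty open interval and a, b : I → ℝ be C² functions with a(t) ≠ 0 for all t ∈ I. Define X(t,s) = ((a(t) − b(t))/√2 + a(t)·s²/(2√2), (a(t) + b(t))/√2 − a(t)·s²/(2√2), s·a(t)) for t ∈ I, s ∈ ℝ, and suppose that for all t ∈ I and s ∈ ℝ: ⟨X_t,X_t⟩ + ⟨X_s,X_s⟩ = 0 (equivalently 2a'(t)b'(t) + a(t)² = 0) and X_tt = X_ss (equivalently a'' = 0 and b'' = −a). Then there exist constants A ≠ 0, B and d such that a(t) = −A·(t + B) and b(t) = A·(t³/6 + B·t²/2 + B²·t/2)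 + d for all t ∈ I. -/
/-- Two functions with the same derivative on a preconnected open set differ by a constant there. -/
theorem exists_forall_eq_add_of_hasDerivAt_eq {I : Set ℝ} (hI : IsOpen I)
    (hc : IsPreconnected I) {f g g' : ℝ → ℝ} (hf : ∀ t ∈ I, HasDerivAt f (g' t) t)
    (hg : ∀ t ∈ I, HasDerivAt g (g' t) t) : ∃ c, ∀ t ∈ I, f t = g t + c :=
  hI.exists_eq_add_of_deriv_eq hc
    (fun t ht => (hf t ht).differentiableAt.differentiableWithinAt)
    (fun t ht => (hg t ht).differentiableAt.differentiableWithinAt)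
    fun t ht => (hf t ht).deriv.trans (hg t ht).deriv.symm

/-- The derivative of the meridian of a surface of revolution with lightlike axis. -/
theorem hasDerivAt_meridian {f g : ℝ → ℝ} {f' g' t : ℝ} (s : ℝ) (hf : HasDerivAt f f' t)
    (hg : HasDerivAt g g' t) :
    HasDerivAt (fun x => (((f x - g x) / √2 + f x * s ^ 2 / (2 * √2),
      (f x + g x) / √2 - f x * s ^ 2 / (2 * √2), s * f x) : ℝ × ℝ × ℝ))
      ((f' - g') / √2 + f' * s ^ 2 / (2 * √2),
      (f' + g') / √2 - f' * s ^ 2 / (2 * √2), s * f') t :=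
  (((hf.sub hg).div_const _).add ((hf.mul_const _).div_const _)).prodMk
    ((((hf.add hg).div_const _).sub ((hf.mul_const _).div_const _)).prodMk (hf.const_mul s))

/-- Minimal timelike surfaces of revolution with lightlike axis are Lorentzian parabolic
catenoids: a(t) = −A(t + B) and b(t) = A(t³/6 + Bt²/2 + B²t/2) + d. -/
theorem stmt17 (I : Set ℝ) (hI : IsOpen I) (hne : I.Nonempty) (hord : I.OrdConnected)
    (a b : ℝ → ℝ) (ha : ContDiffOn ℝ 2 a I) (hb : ContDiffOn ℝ 2 b I)
    (hane : ∀ t ∈ I, a t ≠ 0)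
    (X : ℝ × ℝ → ℝ × ℝ × ℝ)
    (hXdef : ∀ p : ℝ × ℝ, X p =
      ((a p.1 - b p.1) / Real.sqrt 2 + a p.1 * p.2 ^ 2 / (2 * Real.sqrt 2),
       (a p.1 + b p.1) / Real.sqrt 2 - a p.1 * p.2 ^ 2 / (2 * Real.sqrt 2),
       p.2 * a p.1))
    (hconf : ∀ t ∈ I, ∀ s : ℝ,
      mink (pdt X (t, s)) (pdt X (t, s)) + mink (pds X (t, s)) (pds X (t, s)) = 0)
    (hmin : ∀ t ∈ I, ∀ s : ℝ, pdt (pdt X) (t, s) = pds (pds X) (t, s)) :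
    ∃ A B d : ℝ, A ≠ 0 ∧ ∀ t ∈ I,
      a t = -A * (t + B) ∧
      b t = A * (t ^ 3 / 6 + B * t ^ 2 / 2 + B ^ 2 * t / 2) + d := by
  have hc : IsPreconnected I := hord.isPreconnected
  have hda : ∀ t ∈ I, HasDerivAt a (deriv a t) t := fun t ht =>
    ((ha.contDiffAt (hI.mem_nhds ht)).differentiableAt (by norm_num)).hasDerivAt
  have hdb : ∀ t ∈ I, HasDerivAt b (deriv b t) t := fun t ht =>
    ((hb.contDiffAt (hI.mem_nhds ht)).differentiableAt (by norm_num)).hasDerivAt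
  have hdda : ∀ t ∈ I, HasDerivAt (deriv a) (deriv (deriv a) t) t := fun t ht =>
    ((((contDiffOn_succ_iff_deriv_of_isOpen (n := 1) hI).1 ha).2.2.differentiableOn
      (by norm_num)).differentiableAt (hI.mem_nhds ht)).hasDerivAt
  have hddb : ∀ t ∈ I, HasDerivAt (deriv b) (deriv (deriv b) t) t := fun t ht =>
    ((((contDiffOn_succ_iff_deriv_of_isOpen (n := 1) hI).1 hb).2.2.differentiableOn
      (by norm_num)).differentiableAt (hI.mem_nhds ht)).hasDerivAt
  have hXt : ∀ t ∈ I, ∀ s, pdt X (t, s) =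
      ((deriv a t - deriv b t) / √2 + deriv a t * s ^ 2 / (2 * √2),
       (deriv a t + deriv b t) / √2 - deriv a t * s ^ 2 / (2 * √2), s * deriv a t) := by
    intro t ht s
    simp only [pdt, hXdef]
    exact (hasDerivAt_meridian s (hda t ht) (hdb t ht)).deriv
  have hXtt : ∀ t ∈ I, ∀ s, (pdt (pdt X) (t, s)).2.2 = s * deriv (deriv a) t := by
    intro t ht s
    have h := (hasDerivAt_meridian s (hdda t ht) (hddb t ht)).congr_of_eventuallyEq
      (f₁ := fun x => pdt X (x, s))
      (Filter.eventually_of_mem (hI.mem_nhds ht) fun x hx => hXt x hx s)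
    rw [pdt, h.deriv]
  have hXs : ∀ t s, pds X (t, s) = (a t * s / √2, -(a t * s / √2), a t) := by
    intro t s
    simp only [pds, hXdef]
    have hsq : HasDerivAt (fun y : ℝ => a t * y ^ 2 / (2 * √2)) (a t * s / √2) s := by
      refine (((hasDerivAt_pow 2 s).const_mul (a t)).div_const (2 * √2)).congr_deriv ?_
      push_cast
      field_simp
    have h3 : HasDerivAt (fun y : ℝ => y * a t) (a t) s := by
      simpa using (hasDerivAt_id s).mul_const (a t)
    exact ((hsq.const_add _).prodMk ((hsq.const_sub _).prodMk h3)).deriv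
  have hXss : ∀ t s, (pds (pds X) (t, s)).2.2 = 0 := by
    intro t s
    have h1 : HasDerivAt (fun y : ℝ => a t * y / √2) (a t / √2) s := by
      simpa using ((hasDerivAt_id s).const_mul (a t)).div_const √2
    have h := h1.prodMk (h1.neg.prodMk (hasDerivAt_const s (a t)))
    rw [pds]
    simp only [hXs]
    exact congrArg (fun v => v.2.2) h.deriv
  have haff : ∀ t ∈ I, deriv (deriv a) t = 0 := by
    intro t ht
    simpa [hXtt t ht, hXss] using congrArg (fun v => v.2.2) (hmin t ht 1)
  have hode : ∀ t ∈ I, 2 * (deriv a t * deriv b t) + a t ^ 2 = 0 := by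
    intro t ht
    have h := hconf t ht 0
    have h2 : √2 ^ 2 = (2 : ℝ) := Real.sq_sqrt (by norm_num)
    simp only [hXt t ht, hXs, mink] at h
    field_simp at h
    rw [h2] at h
    linarith
  obtain ⟨k, hk⟩ := exists_forall_eq_add_of_hasDerivAt_eq hI hc (g := fun _ => 0) hdda
    fun t ht => by simpa [haff t ht] using hasDerivAt_const t (0 : ℝ)
  simp only [zero_add] at hk
  obtain ⟨m, hm⟩ := exists_forall_eq_add_of_hasDerivAt_eq hI hc (g := fun t => k * t) hda
    fun t ht => by simpa [hk t ht] using (hasDerivAt_id t).const_mul k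
  obtain ⟨t₀, ht₀⟩ := hne
  have hk0 : k ≠ 0 := by
    rintro rfl
    have h := hode t₀ ht₀
    rw [hk t₀ ht₀] at h
    exact hane t₀ ht₀ (by simpa using h)
  obtain ⟨d, hd⟩ := exists_forall_eq_add_of_hasDerivAt_eq hI hc
    (g := fun t => -k * (t ^ 3 / 6 + m / k * t ^ 2 / 2 + (m / k) ^ 2 * t / 2)) hdb
    fun t ht => by
      have h := hode t ht
      rw [hk t ht, hm t ht] at h
      refine (((((hasDerivAt_pow 3 t).div_const 6).add
        (((hasDerivAt_pow 2 t).const_mul (m / k)).div_const 2)).add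
        (((hasDerivAt_id t).const_mul ((m / k) ^ 2)).div_const 2)).const_mul (-k)).congr_deriv ?_
      push_cast
      field_simp
      linarith
  refine ⟨-k, m / k, d, neg_ne_zero.2 hk0, fun t ht => ⟨?_, hd t ht⟩⟩
  rw [hm t ht]
  field_simp
end

section
/- (Minimal null scrolls are B-scrolls.) Let I ⊆ ℝ be an open interval and let α, β : I → ℝ³ be differentiable maps such that for all s ∈ I: ⟨α'(s), α'(s)⟩ = 0, ⟨β(s), β(s)⟩ = 0 and ⟨α'(s), β(s)⟩ = 1 (the data of a null scroll f(t,s) = α(s) + t·β(s)). If the minimality condition ⟨β'(s), α'(s) ×ₗ β(s)⟩ = 0 holds for all s ∈ I, then for every s ∈ I there exists λ ∈ ℝ with β'(s) = λ·β(s); that is, the director field β is parallel to itself and the null scroll is a flat B-scroll. -/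
/-- Expansion of a vector orthogonal to `b` and to `a ×ₗ b` in the null frame `a, b, a ×ₗ b`. -/
theorem eq_mink_smul_of_null_frame {a b w : ℝ × ℝ × ℝ} (haa : mink a a = 0) (hbb : mink b b = 0)
    (hab : mink a b = 1) (hwb : mink w b = 0) (hwn : mink w (lcross a b) = 0) :
    w = mink w a • b := by
  obtain ⟨a₁, a₂, a₃⟩ := a
  obtain ⟨b₁, b₂, b₃⟩ := b
  obtain ⟨w₁, w₂, w₃⟩ := w
  simp only [mink, lcross] at *
  simp only [Prod.smul_mk, smul_eq_mul, Prod.mk.injEq]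
  refine ⟨?_, ?_, ?_⟩
  · linear_combination
      (-w₁ * ((-(a₁ * b₁) + a₂ * b₂ + a₃ * b₃) + 1) + b₁ * (-(w₁ * a₁) + w₂ * a₂ + w₃ * a₃)) * hab
      + (w₁ * (-(b₁ * b₁) + b₂ * b₂ + b₃ * b₃) - b₁ * (-(w₁ * b₁) + w₂ * b₂ + w₃ * b₃)) * haa
      - a₁ * (-(w₁ * a₁) + w₂ * a₂ + w₃ * a₃) * hbb + a₁ * (-(a₁ * b₁) + a₂ * b₂ + a₃ * b₃) * hwb + (-(a₂ * b₃ - a₃ * b₂)) * hwn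
  · linear_combination
      (-w₂ * ((-(a₁ * b₁) + a₂ * b₂ + a₃ * b₃) + 1) + b₂ * (-(w₁ * a₁) + w₂ * a₂ + w₃ * a₃)) * hab
      + (w₂ * (-(b₁ * b₁) + b₂ * b₂ + b₃ * b₃) - b₂ * (-(w₁ * b₁) + w₂ * b₂ + w₃ * b₃)) * haa
      - a₂ * (-(w₁ * a₁) + w₂ * a₂ + w₃ * a₃) * hbb + a₂ * (-(a₁ * b₁) + a₂ * b₂ + a₃ * b₃) * hwb + (a₃ * b₁ - a₁ * b₃) * hwn
  · linear_combination
      (-w₃ * ((-(a₁ * b₁) + a₂ * b₂ + a₃ * b₃) + 1) + b₃ * (-(w₁ * a₁) + w₂ * a₂ + w₃ * a₃)) * hab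
      + (w₃ * (-(b₁ * b₁) + b₂ * b₂ + b₃ * b₃) - b₃ * (-(w₁ * b₁) + w₂ * b₂ + w₃ * b₃)) * haa
      - a₃ * (-(w₁ * a₁) + w₂ * a₂ + w₃ * a₃) * hbb + a₃ * (-(a₁ * b₁) + a₂ * b₂ + a₃ * b₃) * hwb + (a₁ * b₂ - a₂ * b₁) * hwn

theorem HasDerivAt.mink_self {β : ℝ → ℝ × ℝ × ℝ} {v : ℝ × ℝ × ℝ} {s : ℝ} (h : HasDerivAt β v s) :
    HasDerivAt (fun x => mink (β x) (β x)) (2 * mink v (β s)) s := by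
  have k₁ : HasDerivAt (fun x => (β x).1) v.1 s := h.fst
  have k₂ : HasDerivAt (fun x => (β x).2.1) v.2.1 s := h.snd.fst
  have k₃ : HasDerivAt (fun x => (β x).2.2) v.2.2 s := h.snd.snd
  refine (((k₁.mul k₁).neg.add (k₂.mul k₂)).add (k₃.mul k₃)).congr_deriv ?_
  simp only [mink]
  ring

/-- Minimal null scrolls are B-scrolls: for a null scroll f(t,s) = α(s) + t β(s) with
⟨α',α'⟩ = 0, ⟨β,β⟩ = 0, ⟨α',β⟩ = 1, the minimality condition ⟨β', α' ×ₗ β⟩ = 0 forces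
the director field to satisfy β' = λ β. -/
theorem stmt18 (I : Set ℝ) (hI : IsOpen I)
    (α β : ℝ → ℝ × ℝ × ℝ)
    (hα : ∀ s ∈ I, DifferentiableAt ℝ α s) (hβ : ∀ s ∈ I, DifferentiableAt ℝ β s)
    (h1 : ∀ s ∈ I, mink (deriv α s) (deriv α s) = 0)
    (h2 : ∀ s ∈ I, mink (β s) (β s) = 0)
    (h3 : ∀ s ∈ I, mink (deriv α s) (β s) = 1)
    (hmin : ∀ s ∈ I, mink (deriv β s) (lcross (deriv α s) (β s)) = 0) :
    ∀ s ∈ I, ∃ lam : ℝ, deriv β s = lam • β s := by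
  intro s hs
  have hderiv := (hβ s hs).hasDerivAt.mink_self
  have hzero : (fun x => mink (β x) (β x)) =ᶠ[nhds s] fun _ => 0 :=
    Filter.eventually_of_mem (hI.mem_nhds hs) h2
  have horth : 2 * mink (deriv β s) (β s) = 0 :=
    hderiv.unique ((hasDerivAt_const s (0 : ℝ)).congr_of_eventuallyEq hzero)
  exact ⟨_, eq_mink_smul_of_null_frame (h1 s hs) (h2 s hs) (h3 s hs) (by linarith) (hmin s hs)⟩
end

section
/- (Non-uniqueness of the Björling problem for null initial curves.) Let x(u) = ((4/3)u³ + u, (4/3)u³ − u, 2u²), y(v) = (½·sinh(2v), v, ½(cosh(2v) − 1)), z(v) = (v, v, 0), N(u) = (2u, 2u, 1), and set f(u,v) = x(u) + y(v) and g(u,v) = x(u) + z(v). Then: (i) ⟨N(u), N(u)⟩ = 1 and ⟨N(u), x'(u)⟩ = 0 for all u; (ii) for all (u,v): ⟨g_u,g_u⟩ = 0, ⟨g_v,g_v⟩ = 0, ⟨g_u,g_v⟩ = −2 and g_{uv} = 0, so g is a timelike minimal immersion in null coordinates; g(u,0) = x(u) and ⟨N(u), g_v(u,0)⟩ = 0;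 (iii) for all v and all u with |u| < 1/2: ⟨f_u,f_u⟩ = 0, ⟨f_v,f_v⟩ = 0, ⟨f_u,f_v⟩ < 0 and f_{uv} = 0, so f is a timelike minimal immersion there; f(u,0) = x(u) and ⟨N(u), f_v(u,0)⟩ = 0; (iv) the point f(0,1) does not lie in the range of g. Hence f and g are two distinct timelike minimal surfaces containing the null curve x with the same unit normal field N along it. -/
/-- The null cubic x(u) = ((4/3)u³ + u, (4/3)u³ − u, 2u²). -/
noncomputable def xc (u : ℝ) : ℝ × ℝ × ℝ :=
  (4 / 3 * u ^ 3 + u, 4 / 3 * u ^ 3 - u, 2 * u ^ 2)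

/-- The null curve y(v) = (½ sinh(2v), v, ½(cosh(2v) − 1)). -/
noncomputable def yc (v : ℝ) : ℝ × ℝ × ℝ :=
  (Real.sinh (2 * v) / 2, v, (Real.cosh (2 * v) - 1) / 2)

/-- The null curve z(v) = (v, v, 0). -/
def zc (v : ℝ) : ℝ × ℝ × ℝ := (v, v, 0)

/-- The unit normal field N(u) = (2u, 2u, 1) along the null cubic. -/
def Nn (u : ℝ) : ℝ × ℝ × ℝ := (2 * u, 2 * u, 1)

/-- f(u,v) = x(u) + y(v). -/
noncomputable def fS (p : ℝ × ℝ) : ℝ × ℝ × ℝ := xc p.1 + yc p.2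

/-- g(u,v) = x(u) + z(v). -/
noncomputable def gS (p : ℝ × ℝ) : ℝ × ℝ × ℝ := xc p.1 + zc p.2

lemma hasDerivAt_xc (u : ℝ) :
    HasDerivAt xc (4 * u ^ 2 + 1, 4 * u ^ 2 - 1, 4 * u) u := by
  have h3 : HasDerivAt (fun u : ℝ => 4 / 3 * u ^ 3) (4 * u ^ 2) u :=
    ((hasDerivAt_pow 3 u).const_mul (4 / 3 : ℝ)).congr_deriv (by norm_num; ring)
  have h2 : HasDerivAt (fun u : ℝ => 2 * u ^ 2) (4 * u) u :=
    ((hasDerivAt_pow 2 u).const_mul (2 : ℝ)).congr_deriv (by norm_num; ring)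
  exact (h3.add (hasDerivAt_id u)).prodMk ((h3.sub (hasDerivAt_id u)).prodMk h2)

lemma hasDerivAt_yc (v : ℝ) :
    HasDerivAt yc (Real.cosh (2 * v), 1, Real.sinh (2 * v)) v := by
  have h : HasDerivAt (fun v : ℝ => 2 * v) 2 v := by
    simpa using (hasDerivAt_id v).const_mul (2 : ℝ)
  have h1 : HasDerivAt (fun v : ℝ => Real.sinh (2 * v) / 2) (Real.cosh (2 * v)) v :=
    (h.sinh.div_const 2).congr_deriv (by ring)
  have h3 : HasDerivAt (fun v : ℝ => (Real.cosh (2 * v) - 1) / 2) (Real.sinh (2 * v)) v :=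
    ((h.cosh.sub_const 1).div_const 2).congr_deriv (by ring)
  exact h1.prodMk ((hasDerivAt_id v).prodMk h3)

lemma hasDerivAt_zc (v : ℝ) : HasDerivAt zc (1, 1, 0) v :=
  (hasDerivAt_id v).prodMk ((hasDerivAt_id v).prodMk (hasDerivAt_const v 0))

lemma pdt_gS (p : ℝ × ℝ) : pdt gS p = (4 * p.1 ^ 2 + 1, 4 * p.1 ^ 2 - 1, 4 * p.1) :=
  ((hasDerivAt_xc p.1).add_const (zc p.2)).deriv

lemma pds_gS (p : ℝ × ℝ) : pds gS p = (1, 1, 0) :=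
  ((hasDerivAt_zc p.2).const_add (xc p.1)).deriv

lemma pdt_fS (p : ℝ × ℝ) : pdt fS p = (4 * p.1 ^ 2 + 1, 4 * p.1 ^ 2 - 1, 4 * p.1) :=
  ((hasDerivAt_xc p.1).add_const (yc p.2)).deriv

lemma pds_fS (p : ℝ × ℝ) : pds fS p = (Real.cosh (2 * p.2), 1, Real.sinh (2 * p.2)) :=
  ((hasDerivAt_yc p.2).const_add (xc p.1)).deriv

lemma mink_pdt_fS_pds_fS (p : ℝ × ℝ) :
    mink (pdt fS p) (pds fS p) = -2 * (Real.cosh p.2 - 2 * p.1 * Real.sinh p.2) ^ 2 := by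
  rw [pdt_fS, pds_fS]
  simp only [mink, Real.cosh_two_mul, Real.sinh_two_mul]
  linear_combination (4 * p.1 ^ 2 - 1) * Real.cosh_sq_sub_sinh_sq p.2 * (-1)

lemma mul_sinh_lt_cosh {a : ℝ} (ha : |a| < 1) (v : ℝ) : a * Real.sinh v < Real.cosh v := by
  have h : |Real.sinh v| < Real.cosh v :=
    abs_lt_of_sq_lt_sq (by linarith [Real.cosh_sq v]) (Real.cosh_pos v).le
  calc a * Real.sinh v ≤ |a| * |Real.sinh v| := (le_abs_self _).trans (abs_mul _ _).le
    _ ≤ 1 * |Real.sinh v| := by gcongr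
    _ < Real.cosh v := by rwa [one_mul]

lemma gS_ne_fS_zero_one (p : ℝ × ℝ) : gS p ≠ fS (0, 1) := by
  intro h
  obtain ⟨u, v⟩ := p
  simp only [gS, fS, xc, yc, zc, Prod.mk_add_mk, Prod.mk.injEq] at h
  obtain ⟨h1, h2, h3⟩ := h
  rw [Real.sinh_two_mul] at h1
  rw [Real.cosh_two_mul] at h3
  have hcs := Real.cosh_sq_sub_sinh_sq 1
  have hS : 1 < Real.sinh 1 := Real.self_lt_sinh_iff.2 one_pos
  have hC := Real.cosh_pos 1
  have he : Real.cosh 1 + Real.sinh 1 < 2.7182818286 := by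
    rw [Real.cosh_add_sinh]; exact Real.exp_one_lt_d9
  have hu : 2 * u = Real.sinh 1 * Real.cosh 1 - 1 := by linarith
  have hu2 : 2 * u ^ 2 = Real.sinh 1 ^ 2 := by linarith
  have hlo : 0 < u := by nlinarith
  have hhi : u < 1 / 2 := by nlinarith [sq_nonneg (Real.cosh 1 - Real.sinh 1)]
  nlinarith

/-- Non-uniqueness of the Björling problem for null initial curves: f and g are two
distinct timelike minimal surfaces containing the null cubic x with the same unit normal
field N along it. -/
theorem stmt19 :
    (∀ u : ℝ, mink (Nn u) (Nn u) = 1 ∧ mink (Nn u) (deriv xc u) = 0) ∧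
    (∀ p : ℝ × ℝ,
      mink (pdt gS p) (pdt gS p) = 0 ∧ mink (pds gS p) (pds gS p) = 0 ∧
      mink (pdt gS p) (pds gS p) = -2 ∧ pds (pdt gS) p = 0) ∧
    (∀ u : ℝ, gS (u, 0) = xc u ∧ mink (Nn u) (pds gS (u, 0)) = 0) ∧
    (∀ p : ℝ × ℝ, |p.1| < 1 / 2 →
      mink (pdt fS p) (pdt fS p) = 0 ∧ mink (pds fS p) (pds fS p) = 0 ∧
      mink (pdt fS p) (pds fS p) < 0 ∧ pds (pdt fS) p = 0) ∧
    (∀ u : ℝ, fS (u, 0) = xc u ∧ mink (Nn u) (pds fS (u, 0)) = 0) ∧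
    (∀ p : ℝ × ℝ, gS p ≠ fS (0, 1)) := by
  refine ⟨fun u => ⟨?_, ?_⟩, fun p => ⟨?_, ?_, ?_, ?_⟩, fun u => ⟨?_, ?_⟩,
    fun p hp => ⟨?_, ?_, ?_, ?_⟩, fun u => ⟨?_, ?_⟩, gS_ne_fS_zero_one⟩
  · simp only [mink, Nn]
    ring
  · rw [(hasDerivAt_xc u).deriv]
    simp only [mink, Nn]
    ring
  · rw [pdt_gS]
    simp only [mink]
    ring
  · rw [pds_gS]
    simp [mink]
  · rw [pdt_gS, pds_gS]
    simp only [mink]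
    ring
  · simp only [pds, pdt_gS, deriv_const]
  · simp [gS, zc, xc]
  · rw [pds_gS]
    simp [mink, Nn]
  · rw [pdt_fS]
    simp only [mink]
    ring
  · rw [pds_fS]
    simp only [mink]
    linear_combination -Real.cosh_sq_sub_sinh_sq (2 * p.2)
  · have ha : |2 * p.1| < 1 := by
      rw [abs_mul, abs_two]
      linarith
    have := pow_pos (sub_pos.2 (mul_sinh_lt_cosh ha p.2)) 2
    rw [mink_pdt_fS_pds_fS]
    linarith
  · simp only [pds, pdt_fS, deriv_const]
  · simp [fS, yc, xc]
  · rw [pds_fS]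
    simp [mink, Nn]
end
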